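/- Let Γ be a finite tree (a finite connected acyclic simple graph) with at least one edge, and let n ≥ 1. Then the abelianization of the braid group B_n|Γ| = π₁(UC^n(|Γ|)) is a free abelian group of rank Σ_{v} Σ_{i=2}^{d(v)−1} [ C(n+d(v)−2, n−1) − C(n+d(v)−i−1, n−1) ], where the outer sum runs over the vertices v of Γ of degree d(v) ≥ 3 and C(a,b) denotes the binomial coefficient a choose b. -/

import Mathlib

open unitInterval

namespace GraphBraid

/-- Index type for the geometric realization: ordered pairs of adjacent vertices. -/
def EdgeIdx {V : Type} (G : SimpleGraph V) : Type := {p : V × V // G.Adj p.1 p.2}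

/-- The gluing relation for the geometric realization: the point `t` of the copy of
`[0,1]` indexed by `(u,v)` is identified with the point `1 - t` of the copy indexed by
`(v,u)`, and the point `0` of the copy indexed by `(u,v)` is identified with the point `0`
of the copy indexed by `(u,w)`. -/
def GlueRel {V : Type} (G : SimpleGraph V) :
    (Σ _ : EdgeIdx G, I) → (Σ _ : EdgeIdx G, I) → Prop := fun x y =>
  ((x.1.1.1 = y.1.1.2 ∧ x.1.1.2 = y.1.1.1 ∧ (x.2 : ℝ) = 1 - (y.2 : ℝ)) ∨
    (x.1.1.1 = y.1.1.1 ∧ (x.2 : ℝ) = 0 ∧ (y.2 : ℝ) = 0))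

/-- The geometric realization of a finite simple graph. -/
abbrev Realization {V : Type} (G : SimpleGraph V) : Type := Quot (GlueRel G)

/-- The relation identifying injective tuples that differ by a permutation of the
coordinates. -/
def PermRel (n : ℕ) (X : Type) : {f : Fin n → X // Function.Injective f} →
    {f : Fin n → X // Function.Injective f} → Prop := fun x y =>
  ∃ p : Equiv.Perm (Fin n), (x : Fin n → X) ∘ p = (y : Fin n → X)

/-- The unordered configuration space of `n` points in the topological space `X`. -/
abbrev UConf (n : ℕ) (X : Type) [TopologicalSpace X] : Type := Quot (PermRel n X)

end GraphBraid


namespace GraphBraid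

/-- A rooted tree on a type, given by its parent function. -/
structure RTree (N : Type) where
  root : N
  par : N → N
  depth : N → ℕ
  par_root : par root = root
  depth_root : depth root = 0
  depth_par : ∀ v, v ≠ root → depth v = depth (par v) + 1

namespace RTree

variable {N : Type} (T : RTree N)

/-- `u` is an ancestor of `v` (or equal to it). -/
def Anc (u v : N) : Prop := ∃ k, T.par^[k] v = u

lemma anc_refl (v : N) : T.Anc v v := ⟨0, rfl⟩

lemma anc_trans {u v w : N} (h : T.Anc u v) (h' : T.Anc v w) : T.Anc u w := by
  obtain ⟨k, rfl⟩ := h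
  obtain ⟨l, rfl⟩ := h'
  exact ⟨k + l, Function.iterate_add_apply _ _ _ _⟩

lemma anc_par (v : N) : T.Anc (T.par v) v := ⟨1, rfl⟩

lemma iter_root (k : ℕ) : T.par^[k] T.root = T.root := by
  induction k with
  | zero => rfl
  | succ k ih => rw [Function.iterate_succ_apply, T.par_root, ih]

lemma anc_cases {u v : N} (h : T.Anc u v) : u = v ∨ (v ≠ T.root ∧ T.Anc u (T.par v)) := by
  obtain ⟨k, rfl⟩ := h
  by_cases hv : v = T.root
  · left; rw [hv, iter_root]
  · cases k with
    | zero => left; rfl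
    | succ k => right; exact ⟨hv, k, rfl⟩

lemma depth_ind {P : N → Prop} (h0 : P T.root) (h : ∀ v, v ≠ T.root → P (T.par v) → P v)
    (v : N) : P v := by
  induction hd : T.depth v using Nat.strong_induction_on generalizing v with
  | _ d ih =>
    by_cases hv : v = T.root
    · rw [hv]; exact h0
    · exact h v hv (ih _ (by have := T.depth_par v hv; omega) _ rfl)

lemma anc_depth {u v : N} (h : T.Anc u v) : T.depth u ≤ T.depth v := by
  induction v using T.depth_ind with
  | h0 => rcases T.anc_cases h with h | h
          · rw [h]
          · exact absurd rfl h.1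
  | h v hv ih =>
    rcases T.anc_cases h with h | h
    · rw [h]
    · have := ih h.2; have := T.depth_par v hv; omega

lemma anc_eq_of_depth {u v : N} (h : T.Anc u v) (hd : T.depth v ≤ T.depth u) : u = v := by
  rcases T.anc_cases h with h | ⟨hv, h⟩
  · exact h
  · have := T.anc_depth h; have := T.depth_par v hv; omega

lemma anc_antisymm {u v : N} (h : T.Anc u v) (h' : T.Anc v u) : u = v :=
  T.anc_eq_of_depth h (T.anc_depth h')

lemma root_anc (v : N) : T.Anc T.root v := by
  induction v using T.depth_ind with
  | h0 => exact T.anc_refl _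
  | h v hv ih => exact T.anc_trans ih (T.anc_par v)

lemma anc_total {u v b : N} (hu : T.Anc u b) (hv : T.Anc v b) (hd : T.depth u ≤ T.depth v) :
    T.Anc u v := by
  induction b using T.depth_ind with
  | h0 =>
    rcases T.anc_cases hv with h | h
    · rw [h]; exact hu
    · exact absurd rfl h.1
  | h b hb ih =>
    rcases T.anc_cases hv with h | h
    · rw [h]; exact hu
    · rcases T.anc_cases hu with h' | h'
      · have := T.anc_depth h.2; have := T.depth_par b hb; subst h'; omega
      · exact ih h'.2 h.2

lemma eq_of_anc_depth {u v b : N} (hu : T.Anc u b) (hv : T.Anc v b)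
    (hd : T.depth u = T.depth v) : u = v :=
  T.anc_eq_of_depth (T.anc_total hu hv hd.le) hd.ge

lemma depth_eq_zero {v : N} (h : T.depth v = 0) : v = T.root := by
  by_contra hv
  have := T.depth_par v hv; omega

lemma exists_child {w x : N} (h : T.Anc w x) (hne : w ≠ x) :
    ∃ s, s ≠ T.root ∧ T.par s = w ∧ T.Anc s x := by
  induction x using T.depth_ind with
  | h0 =>
    rcases T.anc_cases h with h | h
    · exact absurd h hne
    · exact absurd rfl h.1
  | h x hx ih =>
    rcases T.anc_cases h with h | h
    · exact absurd h hne
    · by_cases hw : w = T.par x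
      · exact ⟨x, hx, hw.symm, T.anc_refl _⟩
      · obtain ⟨s, h1, h2, h3⟩ := ih h.2 hw
        exact ⟨s, h1, h2, T.anc_trans h3 (T.anc_par x)⟩

lemma child_unique {s s' x : N} (hs : s ≠ T.root) (hs' : s' ≠ T.root)
    (hp : T.par s = T.par s') (h : T.Anc s x) (h' : T.Anc s' x) : s = s' :=
  T.eq_of_anc_depth h h' (by rw [T.depth_par s hs, T.depth_par s' hs', hp])

lemma par_ne {v : N} (hv : v ≠ T.root) : T.par v ≠ v := by
  intro h; have := T.depth_par v hv; rw [h] at this; omega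

open Classical in
/-- The branch at `w` containing `x`: the child of `w` above `x`, or `w` itself. -/
noncomputable def br (w x : N) : N :=
  if h : ∃ s, s ≠ T.root ∧ T.par s = w ∧ T.Anc s x then h.choose else w

lemma br_eq {w x s : N} (hs : s ≠ T.root) (hp : T.par s = w) (h : T.Anc s x) :
    T.br w x = s := by
  have hex : ∃ s, s ≠ T.root ∧ T.par s = w ∧ T.Anc s x := ⟨s, hs, hp, h⟩
  rw [br, dif_pos hex]
  obtain ⟨h1, h2, h3⟩ := hex.choose_spec
  exact T.child_unique h1 hs (h2.trans hp.symm) h3 h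

lemma br_not {w x : N} (h : ¬ ∃ s, s ≠ T.root ∧ T.par s = w ∧ T.Anc s x) : T.br w x = w := by
  rw [br, dif_neg h]

lemma br_spec (w x : N) : (T.br w x ≠ T.root ∧ T.par (T.br w x) = w ∧ T.Anc (T.br w x) x) ∨
    (T.br w x = w ∧ ¬ ∃ s, s ≠ T.root ∧ T.par s = w ∧ T.Anc s x) := by
  by_cases hex : ∃ s, s ≠ T.root ∧ T.par s = w ∧ T.Anc s x
  · left
    rw [br, dif_pos hex]
    exact hex.choose_spec
  · right; exact ⟨T.br_not hex, hex⟩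

lemma br_par {w x : N} (hx : x ≠ T.root) (hp : T.par x ≠ w) : T.br w (T.par x) = T.br w x := by
  rcases T.br_spec w x with ⟨h1, h2, h3⟩ | ⟨h1, h2⟩
  · rcases T.anc_cases h3 with h | h
    · rw [h] at h2; exact absurd h2 hp
    · exact T.br_eq h1 h2 h.2
  · rw [h1]
    exact T.br_not fun ⟨s, a, b, c⟩ => h2 ⟨s, a, b, T.anc_trans c (T.anc_par x)⟩

lemma br_child {c : N} (hc : c ≠ T.root) : T.br (T.par c) c = c :=
  T.br_eq hc rfl (T.anc_refl c)

lemma br_self (w : N) : T.br w w = w := by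
  refine T.br_not fun ⟨s, a, b, c⟩ => ?_
  have := T.anc_depth c
  have := T.depth_par s a
  rw [b] at this; omega

lemma br_br (w x : N) : T.br w (T.br w x) = T.br w x := by
  rcases T.br_spec w x with ⟨h1, h2, h3⟩ | ⟨h1, h2⟩
  · exact T.br_eq h1 h2 (T.anc_refl _)
  · rw [h1, br_self]

/-- A linear order which is a depth first search order of the tree. -/
structure IsDFS [LinearOrder N] : Prop where
  par_lt : ∀ v, v ≠ T.root → T.par v < v
  between : ∀ e x, e ≠ T.root → T.par e < x → x < e →
    ∃ s, s ≠ T.root ∧ T.par s = T.par e ∧ s < e ∧ T.Anc s x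
  lower : ∀ e s x, e ≠ T.root → s ≠ T.root → T.par s = T.par e → s < e → T.Anc s x → x < e

section Comb

variable [LinearOrder N] {A : Type*} [AddCommGroup A]

/-- `c` is the smallest non-root element of `c ::ₘ m`. -/
def IsMinIn (c : N) (M : Multiset N) : Prop :=
  c ∈ M ∧ c ≠ T.root ∧ ∀ x ∈ M, x ≠ T.root → c ≤ x

lemma isMinIn_unique {c c' : N} {M : Multiset N} (h : T.IsMinIn c M) (h' : T.IsMinIn c' M) :
    c = c' :=
  le_antisymm (h.2.2 _ h'.1 h'.2.1) (h'.2.2 _ h.1 h.2.1)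

lemma exists_isMinIn {M : Multiset N} (h : ∃ x ∈ M, x ≠ T.root) : ∃ c, T.IsMinIn c M := by
  classical
  obtain ⟨x, hx, hxr⟩ := h
  obtain ⟨c, hc, hmin⟩ := (M.toFinset.filter (· ≠ T.root)).exists_min_image id
    ⟨x, by simp [hx, hxr]⟩
  simp only [ne_eq, Finset.mem_filter, Multiset.mem_toFinset, id_eq, and_imp] at hc hmin
  exact ⟨c, hc.1, hc.2, fun y hy hyr => hmin y hy hyr⟩

lemma sum_depth_lt {c : N} (hc : c ≠ T.root) (m : Multiset N) :
    ((T.par c ::ₘ m).map T.depth).sum < ((c ::ₘ m).map T.depth).sum := by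
  have := T.depth_par c hc
  simp only [Multiset.map_cons, Multiset.sum_cons]; omega

open Classical in
/-- The canonical potential. -/
noncomputable def pot (f : N → Multiset N → A) (M : Multiset N) : A :=
  if h : ∃ c, T.IsMinIn c M then
    pot f (T.par h.choose ::ₘ M.erase h.choose) - f h.choose (M.erase h.choose)
  else 0
termination_by (M.map T.depth).sum
decreasing_by
  have h1 := h.choose_spec
  conv_rhs => rw [← Multiset.cons_erase h1.1]
  exact T.sum_depth_lt h1.2.1 _

lemma pot_min (f : N → Multiset N → A) {c : N} {m : Multiset N} (h : T.IsMinIn c (c ::ₘ m)) :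
    T.pot f (c ::ₘ m) = T.pot f (T.par c ::ₘ m) - f c m := by
  classical
  have hex : ∃ c', T.IsMinIn c' (c ::ₘ m) := ⟨c, h⟩
  have hc : hex.choose = c := T.isMinIn_unique hex.choose_spec h
  rw [pot, dif_pos hex, hc, Multiset.erase_cons_head]

lemma pot_not (f : N → Multiset N → A) {M : Multiset N} (h : ¬ ∃ c, T.IsMinIn c M) :
    T.pot f M = 0 := by
  rw [pot, dif_neg h]

lemma pot_ind {P : Multiset N → Prop} (h0 : ∀ M, (¬ ∃ c, T.IsMinIn c M) → P M)
    (h : ∀ c m, T.IsMinIn c (c ::ₘ m) → P (T.par c ::ₘ m) → P (c ::ₘ m)) (M : Multiset N) :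
    P M := by
  induction hd : (M.map T.depth).sum using Nat.strong_induction_on generalizing M with
  | _ d ih =>
    by_cases hM : ∃ c, T.IsMinIn c M
    · obtain ⟨c, hc⟩ := hM
      obtain ⟨m, rfl⟩ := Multiset.exists_cons_of_mem hc.1
      refine h c m hc (ih _ ?_ _ rfl)
      rw [← hd]; exact T.sum_depth_lt hc.2.1 _
    · exact h0 M hM

lemma pot_map {A' : Type*} [AddCommGroup A'] (θ : A →+ A') (f : N → Multiset N → A)
    (M : Multiset N) : θ (T.pot f M) = T.pot (fun c m => θ (f c m)) M := by
  induction M using T.pot_ind with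
  | h0 M h => rw [pot_not _ _ h, pot_not _ _ h, map_zero]
  | h c m hc ih => rw [pot_min _ _ hc, pot_min _ _ hc, map_sub, ih]

lemma pot_zero {n : ℕ} (f : N → Multiset N → A)
    (h : ∀ c m, m.card + 1 = n → T.IsMinIn c (c ::ₘ m) → f c m = 0)
    (M : Multiset N) (hM : M.card = n) : T.pot f M = 0 := by
  induction M using T.pot_ind with
  | h0 M h => rw [pot_not _ _ h]
  | h c m hc ih =>
    rw [pot_min _ _ hc, h c m (by simpa using hM) hc, ih (by simpa using hM), sub_zero]

/-- The normalized cocycle. -/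
noncomputable def nrm (f : N → Multiset N → A) (c : N) (m : Multiset N) : A :=
  f c m - (T.pot f (T.par c ::ₘ m) - T.pot f (c ::ₘ m))

/-- The commuting squares condition. -/
def Squares (n : ℕ) (f : N → Multiset N → A) : Prop :=
  ∀ c c' m, c ≠ T.root → c' ≠ T.root → T.par c ≠ T.par c' → m.card + 2 = n →
    f c (c' ::ₘ m) + f c' (T.par c ::ₘ m) = f c' (c ::ₘ m) + f c (T.par c' ::ₘ m)

variable {n : ℕ} {f : N → Multiset N → A}

lemma Squares.nrm (hf : T.Squares n f) : T.Squares n (T.nrm f) := by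
  intro c c' m hc hc' hp hm
  have := hf c c' m hc hc' hp hm
  have e1 : c ::ₘ c' ::ₘ m = c' ::ₘ c ::ₘ m := Multiset.cons_swap _ _ _
  have e2 : T.par c ::ₘ c' ::ₘ m = c' ::ₘ T.par c ::ₘ m := Multiset.cons_swap _ _ _
  have e3 : T.par c' ::ₘ c ::ₘ m = c ::ₘ T.par c' ::ₘ m := Multiset.cons_swap _ _ _
  have e4 : T.par c' ::ₘ T.par c ::ₘ m = T.par c ::ₘ T.par c' ::ₘ m := Multiset.cons_swap _ _ _
  simp only [RTree.nrm]
  rw [e1, e2, e3, e4]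
  have h2 : f c (c' ::ₘ m) = f c' (c ::ₘ m) + f c (T.par c' ::ₘ m) - f c' (T.par c ::ₘ m) := by
    rw [← this]; abel
  rw [h2]
  abel

lemma nrm_min {c : N} {m : Multiset N} (h : T.IsMinIn c (c ::ₘ m)) : T.nrm f c m = 0 := by
  rw [nrm, T.pot_min f h]; abel

lemma nrm_lower (hT : T.IsDFS) (hf : T.Squares n f) (c : N) (hc : c ≠ T.root)
    (m : Multiset N) (hm : m.card + 1 = n) (hl : ∀ x ∈ m, T.par c < x → ¬ x < c) :
    T.nrm f c m = 0 := by
  induction hd : (m.map T.depth).sum using Nat.strong_induction_on generalizing m with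
  | _ d ih =>
    by_cases hmin : T.IsMinIn c (c ::ₘ m)
    · exact T.nrm_min hmin
    · have hex : ∃ x ∈ m, x ≠ T.root := by
        by_contra hcon
        push Not at hcon
        refine hmin ⟨by simp, hc, ?_⟩
        intro x hx hxr
        rcases Multiset.mem_cons.1 hx with h | h
        · exact h.ge
        · exact absurd (hcon x h) hxr
      obtain ⟨e, he⟩ := T.exists_isMinIn hex
      have hec : e < c := by
        by_contra hcon
        refine hmin ⟨by simp, hc, ?_⟩
        intro x hx hxr
        rcases Multiset.mem_cons.1 hx with h | h
        · exact h.ge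
        · exact (not_lt.1 hcon).trans (he.2.2 x h hxr)
      have hep : e ≤ T.par c := by
        by_contra hcon
        exact hl e he.1 (not_le.1 hcon) hec
      obtain ⟨m', rfl⟩ := Multiset.exists_cons_of_mem he.1
      have hpe := hT.par_lt e he.2.1
      have hne : T.par c ≠ T.par e := by
        intro h; rw [h] at hep; exact absurd hpe (not_lt.2 hep)
      have hsq := hf.nrm T c e m' hc he.2.1 hne (by simp at hm; omega)
      have z1 : T.nrm f e (T.par c ::ₘ m') = 0 := by
        refine T.nrm_min ⟨by simp, he.2.1, ?_⟩
        intro x hx hxr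
        simp only [Multiset.mem_cons] at hx
        rcases hx with h | h | h
        · exact h.ge
        · rw [h]; exact hep
        · exact he.2.2 x (by simp [h]) hxr
      have z2 : T.nrm f e (c ::ₘ m') = 0 := by
        refine T.nrm_min ⟨by simp, he.2.1, ?_⟩
        intro x hx hxr
        simp only [Multiset.mem_cons] at hx
        rcases hx with h | h | h
        · exact h.ge
        · rw [h]; exact hec.le
        · exact he.2.2 x (by simp [h]) hxr
      have z3 : T.nrm f c (T.par e ::ₘ m') = 0 := by
        refine ih _ ?_ _ ?_ ?_ rfl
        · rw [← hd]; exact T.sum_depth_lt he.2.1 _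
        · simpa using hm
        · intro x hx h1 h2
          rcases Multiset.mem_cons.1 hx with h | h
          · rw [h] at h1; exact absurd (h1.trans hpe) (not_lt.2 hep)
          · exact hl x (by simp [h]) h1 h2
      rw [z1, z2, z3] at hsq
      simpa using hsq

open Classical in
/-- Branch at `w`, with the branch of the root represented by the root. -/
noncomputable def nb (w x : N) : N := if T.br w x = w then T.root else T.br w x

lemma nb_par {w x : N} (hx : x ≠ T.root) (hp : T.par x ≠ w) : T.nb w (T.par x) = T.nb w x := by
  rw [nb, nb, T.br_par hx hp]

lemma nrm_nb (hT : T.IsDFS) (hf : T.Squares n f) (c : N) (hc : c ≠ T.root)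
    (m : Multiset N) (hm : m.card + 1 = n) :
    T.nrm f c m = T.nrm f c (m.map (T.nb (T.par c))) := by
  induction hdc : T.depth c using Nat.strong_induction_on generalizing c m with
  | _ dc ihc =>
  induction hd : (m.map T.depth).sum using Nat.strong_induction_on generalizing m with
  | _ d ih =>
    by_cases hall : ∀ x ∈ m, T.nb (T.par c) x = x
    · rw [Multiset.map_congr rfl hall, Multiset.map_id']
    · classical
      push Not at hall
      obtain ⟨x0, hx0, hx0'⟩ := hall
      obtain ⟨k, hk, hkmin⟩ := (m.toFinset.filter (fun x => T.nb (T.par c) x ≠ x)).exists_min_image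
        id ⟨x0, by simp [hx0, hx0']⟩
      simp only [ne_eq, Finset.mem_filter, Multiset.mem_toFinset, id_eq, and_imp] at hk hkmin
      obtain ⟨hkm, hknb⟩ := hk
      have hkr : k ≠ T.root := by
        rintro rfl
        apply hknb
        have : T.br (T.par c) T.root = T.par c := by
          refine T.br_not fun ⟨s, a, b, e⟩ => a ?_
          rcases T.anc_cases e with h | h
          · exact h
          · exact absurd rfl h.1
        rw [nb, if_pos this]
      have hkp : T.par k ≠ T.par c := by
        intro h
        apply hknb
        have : T.br (T.par c) k = k := T.br_eq hkr h (T.anc_refl _)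
        rw [nb, this, if_neg]
        rw [← h]; exact (T.par_ne hkr).symm
      obtain ⟨m', rfl⟩ := Multiset.exists_cons_of_mem hkm
      simp only [Multiset.card_cons] at hm
      have hsq := hf.nrm T c k m' hc hkr hkp.symm (by omega)
      have key : T.nrm f k (T.par c ::ₘ m') = T.nrm f k (c ::ₘ m') := by
        by_cases hw : T.par k < T.par c ∧ T.par c < k
        · obtain ⟨s, hs1, hs2, hs3, hs4⟩ := hT.between k _ hkr hw.1 hw.2
          have hdk : T.depth k < dc := by
            have := T.depth_par k hkr
            have := T.depth_par s hs1
            have := T.depth_par c hc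
            have := T.anc_depth hs4
            rw [hs2] at *
            omega
          rw [ihc _ hdk k hkr _ (by simpa using hm) rfl,
            ihc _ hdk k hkr (c ::ₘ m') (by simpa using hm) rfl]
          simp only [Multiset.map_cons]
          rw [T.nb_par hc hkp.symm]
        · have hch : ∀ x, x ≠ T.root → T.par x = T.par c → T.par k < x → ¬ x < k := by
            intro x hxr hx h1 h2
            obtain ⟨s, hs1, hs2, hs3, hs4⟩ := hT.between k x hkr h1 h2
            rcases T.anc_cases hs4 with h | h
            · rw [h, hx] at hs2; exact hkp hs2.symm
            · rw [hx] at h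
              apply hw
              refine ⟨?_, hT.lower k s _ hkr hs1 hs2 hs3 h.2⟩
              have a1 : T.depth (T.par k) < T.depth (T.par c) := by
                have := T.depth_par s hs1
                have := T.anc_depth h.2
                rw [hs2] at *
                omega
              by_contra hcon
              have hcp : T.par c < T.par k := lt_of_le_of_ne (not_lt.1 hcon) hkp.symm
              have h3 : ∀ y, T.Anc s y → s ≤ y := by
                intro y
                induction y using T.depth_ind with
                | h0 => intro hy
                        rcases T.anc_cases hy with h | h
                        · exact h.le
                        · exact absurd rfl h.1
                | h y hy ih =>
                  intro hy'
                  rcases T.anc_cases hy' with h | h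
                  · exact h.le
                  · exact (ih h.2).trans (hT.par_lt y hy).le
              have h4 := h3 _ h.2
              have h5 := hT.par_lt s hs1
              rw [hs2] at h5
              exact absurd (h5.trans_le h4) (not_lt.2 hcp.le)
          have hm'low : ∀ x ∈ m', T.par k < x → ¬ x < k := by
            intro x hx h1 h2
            have hxnb : T.nb (T.par c) x = x := by
              by_contra hcon
              exact absurd h2 (not_lt.2 (hkmin x (by simp [hx]) hcon))
            have hxr : x ≠ T.root := by
              rintro rfl
              have : ∀ y : N, T.root ≤ y := by
                intro y
                induction y using T.depth_ind with
                | h0 => exact le_rfl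
                | h y hy ih => exact ih.trans (hT.par_lt y hy).le
              exact absurd h1 (not_lt.2 (this _))
            have : T.br (T.par c) x = x ∧ T.br (T.par c) x ≠ T.par c := by
              by_cases h : T.br (T.par c) x = T.par c
              · rw [nb, if_pos h] at hxnb; exact absurd hxnb.symm hxr
              · rw [nb, if_neg h] at hxnb; exact ⟨hxnb, h⟩
            rcases T.br_spec (T.par c) x with h | h
            · rw [this.1] at h; exact hch x hxr h.2.1 h1 h2
            · exact this.2 h.1
          rw [T.nrm_lower hT hf k hkr _ (by simpa using hm), T.nrm_lower hT hf k hkr _ (by simpa using hm)]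
          · intro x hx h1 h2
            rcases Multiset.mem_cons.1 hx with h | h
            · subst h; exact hch _ hc rfl h1 h2
            · exact hm'low x h h1 h2
          · intro x hx h1 h2
            rcases Multiset.mem_cons.1 hx with h | h
            · subst h; exact hw ⟨h1, h2⟩
            · exact hm'low x h h1 h2
      rw [key] at hsq
      have : T.nrm f c (k ::ₘ m') = T.nrm f c (T.par k ::ₘ m') := by
        rw [add_comm] at hsq; exact add_left_cancel hsq
      rw [this, ih _ (by rw [← hd]; exact T.sum_depth_lt hkr _) _ (by simpa using hm) rfl]
      simp only [Multiset.map_cons]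
      rw [T.nb_par hkr hkp]

lemma nrm_br (hT : T.IsDFS) (hf : T.Squares n f) (c : N) (hc : c ≠ T.root)
    (m : Multiset N) (hm : m.card + 1 = n) :
    T.nrm f c m = T.nrm f c (m.map (T.br (T.par c))) := by
  rw [T.nrm_nb hT hf c hc m hm, T.nrm_nb hT hf c hc (m.map (T.br (T.par c))) (by simpa using hm),
    Multiset.map_map]
  congr 1
  refine Multiset.map_congr rfl fun x _ => ?_
  simp [nb, br_br]

/-- If the normalized cocycle vanishes on all critical cells, then it vanishes. -/
lemma nrm_eq_zero (hT : T.IsDFS) (hf : T.Squares n f)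
    (h : ∀ c, c ≠ T.root → ∀ a : Multiset N, a.card + 1 = n →
      (∀ x ∈ a, x = T.par c ∨ (x ≠ T.root ∧ T.par x = T.par c)) →
      (∃ s ∈ a, s ≠ T.root ∧ T.par s = T.par c ∧ s < c) → T.nrm f c a = 0)
    (c : N) (hc : c ≠ T.root) (m : Multiset N) (hm : m.card + 1 = n) : T.nrm f c m = 0 := by
  by_cases hl : ∀ x ∈ m, T.par c < x → ¬ x < c
  · exact T.nrm_lower hT hf c hc m hm hl
  · push Not at hl
    obtain ⟨x, hx, h1, h2⟩ := hl
    obtain ⟨s, hs1, hs2, hs3, hs4⟩ := hT.between c x hc h1 h2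
    rw [T.nrm_br hT hf c hc m hm]
    refine h c hc _ (by simpa using hm) ?_ ?_
    · intro y hy
      obtain ⟨z, hz, rfl⟩ := Multiset.mem_map.1 hy
      rcases T.br_spec (T.par c) z with h | h
      · right; exact ⟨h.1, h.2.1⟩
      · left; exact h.1
    · exact ⟨s, Multiset.mem_map.2 ⟨x, hx, T.br_eq hs1 hs2 hs4⟩, hs1, hs2, hs3⟩

end Comb

end RTree

end GraphBraid


namespace GraphBraid

lemma list_between {α : Type} [LinearOrder α] (l y : List α) (a : α) (h1 : l < y)
    (h2 : y < l ++ [a]) : ∃ b t, y = l ++ b :: t ∧ b < a := by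
  induction l generalizing y with
  | nil =>
    cases y with
    | nil => exact absurd h1 (lt_irrefl _)
    | cons b t =>
      refine ⟨b, t, rfl, ?_⟩
      simp only [List.nil_append, List.cons_lt_cons_iff] at h2
      rcases h2 with h | h
      · exact h
      · exact absurd h.2 (by simp)
  | cons x l ih =>
    cases y with
    | nil => exact absurd h1 (by simp)
    | cons b t =>
      simp only [List.cons_append, List.cons_lt_cons_iff] at h1 h2
      rcases h1 with h1 | ⟨rfl, h1⟩
      · rcases h2 with h2 | ⟨rfl, h2⟩
        · exact absurd h1 (not_lt.2 h2.le)
        · exact absurd h1 (lt_irrefl _)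
      · rcases h2 with h2 | ⟨_, h2⟩
        · exact absurd h2 (lt_irrefl _)
        · obtain ⟨b, t', rfl, hb⟩ := ih t h1 h2
          exact ⟨b, t', rfl, hb⟩

lemma list_lower {α : Type} [LinearOrder α] (l t : List α) (a b : α) (h : b < a) :
    l ++ b :: t < l ++ [a] := by
  induction l with
  | nil => simp [List.cons_lt_cons_iff, h]
  | cons x l ih => simp only [List.cons_append, List.cons_lt_cons_iff]; right; exact ⟨trivial, ih⟩

lemma list_lt_append {α : Type} [LinearOrder α] (l : List α) (a : α) : l < l ++ [a] := by
  induction l with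
  | nil => simp
  | cons x l ih => simp only [List.cons_append, List.cons_lt_cons_iff]; right; exact ⟨trivial, ih⟩

namespace RTree

variable {N : Type} (T : RTree N)

open Classical in
/-- The address of a vertex: the list of vertices on the path from the root. -/
noncomputable def addr {k : ℕ} (e : N ≃ Fin k) (v : N) : List (Fin k) :=
  if h : v = T.root then [] else addr e (T.par v) ++ [e v]
termination_by T.depth v
decreasing_by have := T.depth_par v h; omega

variable {k : ℕ} (e : N ≃ Fin k)

lemma addr_root : T.addr e T.root = [] := by rw [addr, dif_pos rfl]

lemma addr_cons {v : N} (h : v ≠ T.root) : T.addr e v = T.addr e (T.par v) ++ [e v] := by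
  rw [addr, dif_neg h]

lemma addr_inj : Function.Injective (T.addr e) := by
  intro u v h
  by_cases hu : u = T.root
  · by_cases hv : v = T.root
    · rw [hu, hv]
    · rw [hu, addr_root, T.addr_cons e hv] at h; simp at h
  · by_cases hv : v = T.root
    · rw [hv, addr_root, T.addr_cons e hu] at h; simp at h
    · rw [T.addr_cons e hu, T.addr_cons e hv] at h
      have := List.append_inj_right' h rfl
      simpa using this

lemma addr_of_anc {s x : N} (h : T.Anc s x) : ∃ t, T.addr e x = T.addr e s ++ t := by
  induction x using T.depth_ind with
  | h0 =>
    rcases T.anc_cases h with h | h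
    · exact ⟨[], by rw [h]; simp⟩
    · exact absurd rfl h.1
  | h x hx ih =>
    rcases T.anc_cases h with h | h
    · exact ⟨[], by rw [h]; simp⟩
    · obtain ⟨t, ht⟩ := ih h.2
      exact ⟨t ++ [e x], by rw [T.addr_cons e hx, ht, List.append_assoc]⟩

lemma anc_of_addr {p x : N} {b : Fin k} {t : List (Fin k)}
    (h : T.addr e x = T.addr e p ++ b :: t) :
    ∃ s, e s = b ∧ s ≠ T.root ∧ T.par s = p ∧ T.Anc s x := by
  induction x using T.depth_ind generalizing t with
  | h0 => rw [addr_root] at h; simp at h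
  | h x hx ih =>
    rcases List.eq_nil_or_concat t with rfl | ⟨t', z, rfl⟩
    · rw [T.addr_cons e hx] at h
      have h1 := List.append_inj_left' h rfl
      have h2 := List.append_inj_right' h rfl
      exact ⟨x, by simpa using h2, hx, T.addr_inj e h1, T.anc_refl _⟩
    · rw [T.addr_cons e hx, List.concat_eq_append, ← List.cons_append, ← List.append_assoc] at h
      have h1 := List.append_inj_left' h rfl
      obtain ⟨s, a1, a2, a3, a4⟩ := ih h1
      exact ⟨s, a1, a2, a3, T.anc_trans a4 (T.anc_par x)⟩

lemma exists_dfs [Finite N] : ∃ o : LinearOrder N, @IsDFS N T o := by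
  obtain ⟨k, ⟨e⟩⟩ := Finite.exists_equiv_fin N
  letI o : LinearOrder N := LinearOrder.lift' (T.addr e) (T.addr_inj e)
  have hlt : ∀ u v : N, u < v ↔ T.addr e u < T.addr e v := fun _ _ => Iff.rfl
  refine ⟨o, ?_, ?_, ?_⟩
  · intro v hv
    rw [hlt, T.addr_cons e hv]
    exact list_lt_append _ _
  · intro c x hc h1 h2
    rw [hlt] at h1 h2
    rw [T.addr_cons e hc] at h2
    obtain ⟨b, t, h3, h4⟩ := list_between _ _ _ h1 h2
    obtain ⟨s, a1, a2, a3, a4⟩ := T.anc_of_addr e h3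
    refine ⟨s, a2, a3, ?_, a4⟩
    rw [hlt, T.addr_cons e a2, T.addr_cons e hc, a3, a1]
    exact list_lower _ _ _ _ h4
  · intro c s x hc hs hp hsc hsx
    rw [hlt] at hsc ⊢
    obtain ⟨t, ht⟩ := T.addr_of_anc e hsx
    rw [T.addr_cons e hc, T.addr_cons e hs, hp] at hsc
    rw [ht, T.addr_cons e hc, T.addr_cons e hs, hp, List.append_assoc]
    apply list_lower
    rcases lt_trichotomy (e s) (e c) with h | h | h
    · exact h
    · rw [h] at hsc; exact absurd hsc (lt_irrefl _)
    · exact absurd (hsc.trans (list_lower (T.addr e (T.par c)) [] _ _ h)) (lt_irrefl _)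

end RTree

end GraphBraid


set_option linter.unusedSectionVars false
set_option linter.style.haveILetI false

open unitInterval Topology

namespace GraphBraid

/-- A homotopy invariant additive function on the paths of a space. -/
structure PF (X : Type) [TopologicalSpace X] (A : Type) [AddCommGroup A] where
  val : ∀ {x y : X}, Path x y → A
  val_trans : ∀ {x y z : X} (p : Path x y) (q : Path y z), val (p.trans q) = val p + val q
  val_hom : ∀ {x y : X} (p q : Path x y), p.Homotopic q → val p = val q

namespace PF

variable {X : Type} [TopologicalSpace X] {A : Type} [AddCommGroup A] (ψ : PF X A)

lemma val_refl (x : X) : ψ.val (Path.refl x) = 0 := by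
  have h1 := ψ.val_trans (Path.refl x) (Path.refl x)
  rw [Path.refl_trans_refl] at h1
  simpa using h1

lemma val_symm {x y : X} (p : Path x y) : ψ.val p.symm = - ψ.val p := by
  have h1 := ψ.val_trans p p.symm
  have h2 : ψ.val (p.trans p.symm) = ψ.val (Path.refl x) :=
    ψ.val_hom _ _ ⟨(Path.Homotopy.reflTransSymm p).symm⟩
  rw [h2, val_refl] at h1
  exact (neg_eq_of_add_eq_zero_right h1.symm).symm

lemma val_cast {x y x' y' : X} (p : Path x y) (hx : x' = x) (hy : y' = y) :
    ψ.val (p.cast hx hy) = ψ.val p := by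
  subst hx; subst hy; rfl

section ev

variable {S S' : Type} [TopologicalSpace S] [SimplyConnectedSpace S] [TopologicalSpace S']
  [SimplyConnectedSpace S']

/-- The value of the path functional between two points of a simply connected space mapping
to `X`. -/
noncomputable def ev (F : C(S, X)) (s s' : S) : A :=
  ψ.val ((PathConnectedSpace.somePath s s').map F.continuous)

lemma ev_eq (F : C(S, X)) {s s' : S} (p : Path s s') :
    ψ.val (p.map F.continuous) = ψ.ev F s s' := by
  apply ψ.val_hom
  exact (SimplyConnectedSpace.paths_homotopic p _).map F

lemma ev_add (F : C(S, X)) (s s' s'' : S) : ψ.ev F s s' + ψ.ev F s' s'' = ψ.ev F s s'' := by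
  rw [← ψ.ev_eq F ((PathConnectedSpace.somePath s s').trans (PathConnectedSpace.somePath s' s'')),
    Path.map_trans, ψ.val_trans]
  rfl

lemma ev_self (F : C(S, X)) (s : S) : ψ.ev F s s = 0 := by
  have := ψ.ev_add F s s s
  simpa using this

lemma ev_comp (F : C(S, X)) (g : C(S', S)) (s s' : S') :
    ψ.ev F (g s) (g s') = ψ.ev (F.comp g) s s' := by
  rw [← ψ.ev_eq F ((PathConnectedSpace.somePath s s').map g.continuous)]
  rfl

end ev

lemma local_global {S : Type} [TopologicalSpace S] (F : C(S, X)) (g : S → A)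
    (h : ∀ s : S, ∃ W ∈ 𝓝 s, ∀ (a b : S) (p : Path a b), Set.range p ⊆ W →
      ψ.val (p.map F.continuous) = g b - g a) (a b : S) (p : Path a b) :
    ψ.val (p.map F.continuous) = g b - g a := by
  choose W hW hp using h
  obtain ⟨t, h0, hm, ⟨n, hn⟩, hc⟩ := exists_monotone_Icc_subset_open_cover_unitInterval
    (c := fun s : S => p ⁻¹' interior (W s)) (fun s => isOpen_interior.preimage p.continuous)
    (fun u _ => Set.mem_iUnion.2 ⟨p u, mem_interior_iff_mem_nhds.2 (hW _)⟩)
  have key : ∀ k, ψ.val ((p.subpath 0 (t k)).map F.continuous) = g (p (t k)) - g (p 0) := by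
    intro k
    induction k with
    | zero =>
      rw [h0, Path.subpath_self, sub_self]
      exact ψ.val_refl _
    | succ k ih =>
      have h1 : ψ.val (((p.subpath 0 (t k)).trans (p.subpath (t k) (t (k+1)))).map F.continuous)
          = ψ.val ((p.subpath 0 (t (k+1))).map F.continuous) :=
        ψ.val_hom _ _ (Path.Homotopic.map ⟨Path.Homotopy.subpathTransSubpath p 0 (t k) (t (k+1))⟩ F)
      rw [← h1, Path.map_trans, ψ.val_trans, ih]
      obtain ⟨s, hs⟩ := hc k
      rw [hp s _ _ (p.subpath (t k) (t (k+1))) ?_]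
      · abel
      · rw [Path.range_subpath_of_le _ _ _ (hm (Nat.le_succ k))]
        rintro _ ⟨u, hu, rfl⟩
        exact interior_subset (hs hu)
  have := key n
  rw [hn n le_rfl, Path.subpath_zero_one] at this
  have e : (p.cast p.source p.target).map F.continuous =
    (p.map F.continuous).cast (congrArg F p.source) (congrArg F p.target) := rfl
  rw [e, val_cast] at this
  simpa using this

end PF

section Integral

variable {X : Type} [TopologicalSpace X] {A : Type} [AddCommGroup A]

/-- A locally additive function of two variables. -/
structure LocAdd (c : X → X → A) (O : X → Set X) : Prop where
  isOpen : ∀ x, IsOpen (O x)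
  mem : ∀ x, x ∈ O x
  add : ∀ x, ∀ y ∈ O x, ∀ z ∈ O x, ∀ w ∈ O x, c y z + c z w = c y w

variable {c : X → X → A} {O : X → Set X}

lemma LocAdd.self (hc : LocAdd c O) (x : X) : c x x = 0 := by
  have := hc.add x x (hc.mem x) x (hc.mem x) x (hc.mem x)
  simpa using this

/-- `u` is a lift of the path `γ` (to the covering defined by `c`). -/
def IsLift (c : X → X → A) (γ : I → X) (u : I → A) : Prop :=
  ∀ t₀ : I, ∀ᶠ t in 𝓝 t₀, u t + c (γ t) (γ t₀) = u t₀

lemma IsLift.comp {γ : I → X} {u : I → A} (h : IsLift c γ u) (r : I → I) (hr : Continuous r) :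
    IsLift c (γ ∘ r) (u ∘ r) := fun t₀ => hr.continuousAt.eventually (h (r t₀))

lemma IsLift.unique {γ : I → X} {u u' : I → A} (h : IsLift c γ u) (h' : IsLift c γ u') :
    u 1 - u 0 = u' 1 - u' 0 := by
  have hl : IsLocallyConstant (fun t => u t - u' t) := by
    rw [IsLocallyConstant.iff_eventually_eq]
    intro t₀
    filter_upwards [h t₀, h' t₀] with t e e'
    rw [← e, ← e']; abel
  have := hl.apply_eq_of_isPreconnected isPreconnected_univ (Set.mem_univ 1) (Set.mem_univ 0)
  rw [sub_eq_sub_iff_add_eq_add] at this ⊢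
  rw [this, add_comm]

/-- The bundle core. -/
def LocAdd.core (hc : LocAdd c O) [TopologicalSpace A] [DiscreteTopology A] : FiberBundleCore X X A where
  baseSet := O
  isOpen_baseSet := hc.isOpen
  indexAt := id
  mem_baseSet_at := hc.mem
  coordChange i j y a := a - c y i + c y j
  coordChange_self i y hy a := by simp
  continuousOn_coordChange i j := by
    rw [(((hc.isOpen i).inter (hc.isOpen j)).prod isOpen_univ).continuousOn_iff]
    rintro ⟨y, a⟩ ⟨⟨h1, h2⟩, -⟩
    have : (fun p : X × A => p.2 - c y i + c y j) =ᶠ[𝓝 (y, a)]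
        fun p => p.2 - c p.1 i + c p.1 j := by
      filter_upwards [(((hc.isOpen i).inter (hc.isOpen j)).prod isOpen_univ).mem_nhds
        (show (y, a) ∈ (O i ∩ O j) ×ˢ Set.univ from ⟨⟨h1, h2⟩, trivial⟩)] with p hp
      have e1 := hc.add i p.1 hp.1.1 y h1 i (hc.mem i)
      have e2 := hc.add j p.1 hp.1.2 y h2 j (hc.mem j)
      rw [← e1, ← e2]; abel
    refine ContinuousAt.congr ?_ this
    have : Continuous fun a : A => a - c y i + c y j := continuous_of_discreteTopology
    exact (this.comp continuous_snd).continuousAt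
  coordChange_comp i j k x hx v := by abel

lemma LocAdd.continuous_iff (hc : LocAdd c O) [TopologicalSpace A] [DiscreteTopology A] (γ : C(I, X)) (u : I → A) :
    Continuous (fun t => (⟨γ t, u t⟩ : hc.core.TotalSpace)) ↔ IsLift c γ u := by
  rw [continuous_iff_continuousAt]
  refine forall_congr' fun t₀ => ?_
  have hs : (⟨γ t₀, u t₀⟩ : hc.core.TotalSpace) ∈ (hc.core.localTriv (γ t₀)).source := by
    rw [FiberBundleCore.mem_localTriv_source]
    exact hc.mem _
  have hev : ∀ᶠ t in 𝓝 t₀, γ t ∈ O (γ t₀) :=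
    γ.continuous.continuousAt.eventually ((hc.isOpen _).mem_nhds (hc.mem _))
  have e1 : ∀ t, (hc.core.localTriv (γ t₀)) ⟨γ t, u t⟩ = (γ t, u t + c (γ t) (γ t₀)) := by
    intro t
    rw [FiberBundleCore.localTriv_apply]
    show (_, u t - c (γ t) (γ t) + c (γ t) (γ t₀)) = _
    rw [hc.self]; simp
  rw [(hc.core.localTriv (γ t₀)).toOpenPartialHomeomorph.continuousAt_iff_continuousAt_comp_left
    (f := fun t => (⟨γ t, u t⟩ : hc.core.TotalSpace))]
  · have : ((hc.core.localTriv (γ t₀)).toOpenPartialHomeomorph ∘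
        fun t => (⟨γ t, u t⟩ : hc.core.TotalSpace)) =
        fun t => (γ t, u t + c (γ t) (γ t₀)) := funext e1
    rw [this]
    constructor
    · intro h
      have h2 := h.snd
      have h3 := h2.eventually (p := fun z => z = u t₀ + c (γ t₀) (γ t₀))
        (by rw [nhds_discrete]; exact rfl)
      simpa [hc.self] using h3
    · intro h
      refine γ.continuous.continuousAt.prodMk ?_
      refine continuousAt_const.congr (f := fun _ => u t₀) ?_
      filter_upwards [h] with t ht
      exact ht.symm
  · filter_upwards [hev] with t ht
    show _ ∈ (hc.core.localTriv (γ t₀)).source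
    rw [FiberBundleCore.mem_localTriv_source]
    exact ht

lemma LocAdd.isCov (hc : LocAdd c O) [TopologicalSpace A] [DiscreteTopology A] :
    IsCoveringMap (Bundle.TotalSpace.proj : hc.core.TotalSpace → X) :=
  FiberBundle.isCoveringMap

lemma LocAdd.exists_lift (hc : LocAdd c O) (γ : C(I, X)) : ∃ u, u 0 = 0 ∧ IsLift c γ u := by
  letI : TopologicalSpace A := ⊥
  haveI : DiscreteTopology A := ⟨rfl⟩
  let L := hc.isCov.liftPath γ ⟨γ 0, (0 : A)⟩ rfl
  have hL : ∀ t, (L t).1 = γ t := fun t => congr_fun (hc.isCov.liftPath_lifts γ ⟨γ 0, (0 : A)⟩ rfl) t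
  refine ⟨fun t => (L t).2, ?_, ?_⟩
  · show (L 0).2 = (0 : A)
    have : L 0 = ⟨γ 0, (0 : A)⟩ := hc.isCov.liftPath_zero γ ⟨γ 0, (0 : A)⟩ rfl
    rw [this]
  · refine (hc.continuous_iff γ _).1 ?_
    convert L.continuous using 2 with t
    rw [← hL t]

lemma LocAdd.homotopic (hc : LocAdd c O) {x y : X} (p q : Path x y) (h : p.Homotopic q)
    {u v : I → A} (hu : IsLift c p u) (hv : IsLift c q v) : u 1 - u 0 = v 1 - v 0 := by
  letI : TopologicalSpace A := ⊥
  haveI : DiscreteTopology A := ⟨rfl⟩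
  have hl : ∀ (p : Path x y) (u : I → A), IsLift c p u → ∀ h0,
      (hc.isCov.liftPath p ⟨x, (0 : A)⟩ h0 1) = ⟨y, u 1 - u 0⟩ := by
    intro p u hu h0
    have hu' : IsLift c p (fun t => u t - u 0) := by
      intro t₀
      filter_upwards [hu t₀] with t ht
      rw [← ht]; abel
    have h1 := (hc.continuous_iff p.toContinuousMap _).2 hu'
    have h2 := (hc.isCov.eq_liftPath_iff (γ := p.toContinuousMap) (e := ⟨x, (0 : A)⟩) h0).2
      ⟨h1, funext fun _ => rfl, by
        have : p.toContinuousMap 0 = x := p.source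
        simp only [sub_self]
        rw [this]⟩
    have h3 := congr_fun h2 1
    refine h3.symm.trans ?_
    have : p.toContinuousMap 1 = y := p.target
    show (⟨p.toContinuousMap 1, u 1 - u 0⟩ : hc.core.TotalSpace) = _
    rw [this]
  have e := hc.isCov.liftPath_apply_one_eq_of_homotopicRel h ⟨x, (0 : A)⟩ p.source q.source
  have e1 := hl p u hu p.source
  have e2 := hl q v hv q.source
  have e3 := e1.symm.trans (e.trans e2)
  have : ∀ a b : A, (⟨y, a⟩ : hc.core.TotalSpace) = ⟨y, b⟩ → a = b := by
    intro a b hab; cases hab; rfl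
  exact this _ _ e3

/-- The integral of a locally additive function. -/
noncomputable def LocAdd.int (hc : LocAdd c O) : PF X A where
  val p := (hc.exists_lift p.toContinuousMap).choose 1
  val_trans p q := by
    have key : ∀ {x y : X} (p : Path x y) (u : I → A), IsLift c p u →
        (hc.exists_lift p.toContinuousMap).choose 1 = u 1 - u 0 := by
      intro x y p u hu
      have h := (hc.exists_lift p.toContinuousMap).choose_spec
      have := h.2.unique hu
      rw [h.1, sub_zero] at this
      exact this
    have h := (hc.exists_lift (p.trans q).toContinuousMap).choose_spec
    set u := (hc.exists_lift (p.trans q).toContinuousMap).choose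
    have hp : IsLift c p (u ∘ fun t : I => ⟨(t : ℝ) / 2, by
        constructor <;> [linarith [t.2.1]; linarith [t.2.2]]⟩) := by
      convert h.2.comp (fun t : I => ⟨(t : ℝ) / 2, by
        constructor <;> [linarith [t.2.1]; linarith [t.2.2]]⟩) (by fun_prop) using 1
      funext t
      simp only [Path.coe_toContinuousMap, Function.comp, Path.trans_apply]
      rw [dif_pos (by linarith [t.2.2])]
      congr 1
      ext; simp; ring
    have hq : IsLift c q (u ∘ fun t : I => ⟨((t : ℝ) + 1) / 2, by
        constructor <;> [linarith [t.2.1]; linarith [t.2.2]]⟩) := by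
      convert h.2.comp (fun t : I => ⟨((t : ℝ) + 1) / 2, by
        constructor <;> [linarith [t.2.1]; linarith [t.2.2]]⟩) (by fun_prop) using 1
      funext t
      simp only [Path.coe_toContinuousMap, Function.comp, Path.trans_apply]
      split_ifs with ht
      · have : t = 0 := by ext; show (t : ℝ) = 0; linarith [t.2.1]
        subst this
        simp
      · congr 1
        ext; simp; ring
    rw [key p _ hp, key q _ hq]
    simp only [Function.comp]
    have a1 : (⟨((1 : I) : ℝ) / 2, by norm_num⟩ : I) = ⟨(((0 : I) : ℝ) + 1) / 2, by norm_num⟩ := by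
      ext; simp
    have a2 : (⟨((0 : I) : ℝ) / 2, by norm_num⟩ : I) = 0 := by ext; simp
    have a3 : (⟨(((1 : I) : ℝ) + 1) / 2, by norm_num⟩ : I) = 1 := by ext; simp
    rw [a1, a2, a3, h.1]
    abel
  val_hom p q h := by
    have h1 := (hc.exists_lift p.toContinuousMap).choose_spec
    have h2 := (hc.exists_lift q.toContinuousMap).choose_spec
    have := hc.homotopic p q h h1.2 h2.2
    rw [h1.1, h2.1, sub_zero, sub_zero] at this
    exact this

lemma LocAdd.int_local (hc : LocAdd c O) (x : X) {a b : X} (p : Path a b)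
    (hp : Set.range p ⊆ O x) : hc.int.val p = c a b := by
  have h := (hc.exists_lift p.toContinuousMap).choose_spec
  have hu : IsLift c p (fun t => c a (p t)) := by
    intro t₀
    filter_upwards with t
    have : ∀ t, p t ∈ O x := fun t => hp ⟨t, rfl⟩
    exact hc.add x a (by simpa using this 0) _ (this _) _ (this _)
  have := h.2.unique hu
  rw [h.1, sub_zero] at this
  rw [show hc.int.val p = (hc.exists_lift p.toContinuousMap).choose 1 from rfl, this]
  simp [hc.self]

end Integral

end GraphBraid


set_option linter.unusedSectionVars false

open unitInterval Topology

namespace GraphBraid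

namespace PF

variable {X : Type} [TopologicalSpace X] {A A' : Type} [AddCommGroup A] [AddCommGroup A']

/-- Change of coefficients. -/
def map (ψ : PF X A) (θ : A →+ A') : PF X A' where
  val p := θ (ψ.val p)
  val_trans p q := by rw [ψ.val_trans, map_add]
  val_hom p q h := by rw [ψ.val_hom p q h]

/-- Difference of path functionals. -/
def sub (ψ ψ' : PF X A) : PF X A where
  val p := ψ.val p - ψ'.val p
  val_trans p q := by rw [ψ.val_trans, ψ'.val_trans]; abel
  val_hom p q h := by rw [ψ.val_hom p q h, ψ'.val_hom p q h]

/-- The homomorphism on the fundamental group defined by a path functional. -/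
def toHom (ψ : PF X A) (x₀ : X) : FundamentalGroup X x₀ →* Multiplicative A where
  toFun := fun p => Multiplicative.ofAdd (Quotient.lift ψ.val ψ.val_hom p)
  map_one' := by
    show Multiplicative.ofAdd (ψ.val (Path.refl x₀)) = 1
    rw [ψ.val_refl]; rfl
  map_mul' := by
    intro p q
    induction p using Quotient.inductionOn with | _ p
    induction q using Quotient.inductionOn with | _ q
    show Multiplicative.ofAdd (ψ.val (q.trans p)) = Multiplicative.ofAdd (ψ.val p + ψ.val q)
    rw [ψ.val_trans, add_comm]

lemma hom_trans {x₀ : X} (χ : FundamentalGroup X x₀ →* Multiplicative A)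
    (p q : Path.Homotopic.Quotient x₀ x₀) :
    Multiplicative.toAdd (χ (FundamentalGroup.fromPath (p.trans q))) =
      Multiplicative.toAdd (χ (FundamentalGroup.fromPath p)) +
      Multiplicative.toAdd (χ (FundamentalGroup.fromPath q)) := by
  have : FundamentalGroup.fromPath (p.trans q) =
    FundamentalGroup.fromPath q * FundamentalGroup.fromPath p := rfl
  rw [this, map_mul, toAdd_mul, add_comm]

lemma quot_aux {x₀ x y z : X} (a : Path.Homotopic.Quotient x₀ x)
    (b : Path.Homotopic.Quotient x₀ y) (c : Path.Homotopic.Quotient x₀ z)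
    (p : Path.Homotopic.Quotient x y) (q : Path.Homotopic.Quotient y z) :
    (a.trans (p.trans q)).trans c.symm =
      ((a.trans p).trans b.symm).trans ((b.trans q).trans c.symm) := by
  simp only [Path.Homotopic.Quotient.trans_assoc]
  congr 2
  rw [← Path.Homotopic.Quotient.trans_assoc b.symm, Path.Homotopic.Quotient.symm_trans,
    Path.Homotopic.Quotient.refl_trans]

/-- The path functional defined by a homomorphism on the fundamental group. -/
noncomputable def ofHom [PathConnectedSpace X] (x₀ : X)
    (χ : FundamentalGroup X x₀ →* Multiplicative A) : PF X A where
  val {x y} p := Multiplicative.toAdd (χ (FundamentalGroup.fromPath (Path.Homotopic.Quotient.mk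
    (((PathConnectedSpace.somePath x₀ x).trans p).trans (PathConnectedSpace.somePath x₀ y).symm))))
  val_trans {x y z} p q := by
    rw [← hom_trans]
    simp only [Path.Homotopic.Quotient.mk_trans, Path.Homotopic.Quotient.mk_symm]
    rw [quot_aux _ (Path.Homotopic.Quotient.mk (PathConnectedSpace.somePath x₀ y))]
  val_hom {x y} p q h := by
    have : Path.Homotopic.Quotient.mk (((PathConnectedSpace.somePath x₀ x).trans p).trans
        (PathConnectedSpace.somePath x₀ y).symm) = Path.Homotopic.Quotient.mk
        (((PathConnectedSpace.somePath x₀ x).trans q).trans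
        (PathConnectedSpace.somePath x₀ y).symm) :=
      Path.Homotopic.Quotient.eq.2 (((Path.Homotopic.refl _).hcomp h).hcomp (Path.Homotopic.refl _))
    rw [this]

lemma ofHom_loop [PathConnectedSpace X] (x₀ : X)
    (χ : FundamentalGroup X x₀ →* Multiplicative A) (p : Path x₀ x₀) :
    (ofHom x₀ χ).val p = Multiplicative.toAdd (χ (FundamentalGroup.fromPath
      (Path.Homotopic.Quotient.mk p))) := by
  show Multiplicative.toAdd (χ (FundamentalGroup.fromPath (Path.Homotopic.Quotient.mk
    (((PathConnectedSpace.somePath x₀ x₀).trans p).trans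
      (PathConnectedSpace.somePath x₀ x₀).symm)))) = _
  set t := PathConnectedSpace.somePath x₀ x₀
  simp only [Path.Homotopic.Quotient.mk_trans, Path.Homotopic.Quotient.mk_symm]
  rw [hom_trans, hom_trans]
  have : Multiplicative.toAdd (χ (FundamentalGroup.fromPath
      (Path.Homotopic.Quotient.mk t).symm)) = - Multiplicative.toAdd (χ (FundamentalGroup.fromPath
      (Path.Homotopic.Quotient.mk t))) := by
    rw [← toAdd_inv, ← map_inv]; rfl
  rw [this]; abel

lemma exists_pot [PathConnectedSpace X] (ψ : PF X A) (x₀ : X)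
    (h : ∀ p : Path x₀ x₀, ψ.val p = 0) :
    ∃ g : X → A, ∀ (x y : X) (p : Path x y), ψ.val p = g y - g x := by
  refine ⟨fun x => ψ.val (PathConnectedSpace.somePath x₀ x), fun x y p => ?_⟩
  have := h (((PathConnectedSpace.somePath x₀ x).trans p).trans
    (PathConnectedSpace.somePath x₀ y).symm)
  rw [ψ.val_trans, ψ.val_trans, ψ.val_symm] at this
  rw [eq_sub_iff_add_eq, ← sub_eq_zero, ← this]; abel

theorem abelianization_iso [PathConnectedSpace X] (x₀ : X) (K : Type)
    (s : ∀ (A : Type) [AddCommGroup A], PF X A → K → A)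
    (s_map : ∀ (A A' : Type) [AddCommGroup A] [AddCommGroup A'] (θ : A →+ A') (ψ : PF X A) (k : K),
      s A' (ψ.map θ) k = θ (s A ψ k))
    (s_sub : ∀ (A : Type) [AddCommGroup A] (ψ ψ' : PF X A) (k : K),
      s A (ψ.sub ψ') k = s A ψ k - s A ψ' k)
    (s_loop : ∀ (A : Type) [AddCommGroup A] (ψ : PF X A), (∀ p : Path x₀ x₀, ψ.val p = 0) →
      ∀ k, s A ψ k = 0)
    (s_inj : ∀ (A : Type) [AddCommGroup A] (ψ : PF X A), (∀ k, s A ψ k = 0) →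
      ∀ p : Path x₀ x₀, ψ.val p = 0)
    (Φ : PF X (FreeAbelianGroup K)) (hΦ : ∀ k, s _ Φ k = FreeAbelianGroup.of k) :
    Nonempty (Abelianization (FundamentalGroup X x₀) ≃* Multiplicative (FreeAbelianGroup K)) := by
  let H := Additive (Abelianization (FundamentalGroup X x₀))
  let ab : PF X H := ofHom x₀ (A := H) (Abelianization.of (G := FundamentalGroup X x₀))
  have hab : ∀ p : Path x₀ x₀, ab.val p =
      Additive.ofMul (Abelianization.of (FundamentalGroup.fromPath
        (Path.Homotopic.Quotient.mk p))) := fun p => ofHom_loop x₀ _ p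
  let θ' : Abelianization (FundamentalGroup X x₀) →* Multiplicative (FreeAbelianGroup K) :=
    Abelianization.lift (Φ.toHom x₀)
  let θ : H →+ FreeAbelianGroup K := MonoidHom.toAdditiveLeft θ'
  have hθ : ∀ p : Path x₀ x₀, θ (ab.val p) = Φ.val p := by
    intro p
    rw [hab]
    show Multiplicative.toAdd (θ' (Abelianization.of _)) = _
    simp only [θ', Abelianization.lift_apply_of]
    rfl
  let sg : FreeAbelianGroup K →+ H := FreeAbelianGroup.lift (fun k => s H ab k)
  have h1 : ∀ k, θ (s H ab k) = FreeAbelianGroup.of k := by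
    intro k
    have := s_loop _ ((ab.map θ).sub Φ) (fun p => by
      show θ (ab.val p) - Φ.val p = 0
      rw [hθ, sub_self]) k
    rw [s_sub, s_map, hΦ, sub_eq_zero] at this
    exact this
  have h2 : ∀ y, θ (sg y) = y := by
    intro y
    have : θ.comp sg = AddMonoidHom.id _ := by
      apply FreeAbelianGroup.lift_ext
      intro k
      simp [sg, h1]
    exact DFunLike.congr_fun this y
  have h3 : ∀ z : H, sg (θ z) = z := by
    have key : ∀ p : Path x₀ x₀, sg (θ (ab.val p)) = ab.val p := by
      intro p
      have := s_inj _ (ab.sub ((ab.map θ).map sg)) (fun k => by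
        rw [s_sub, s_map, s_map, h1]
        simp [sg]) p
      exact (sub_eq_zero.1 this).symm
    intro z
    obtain ⟨g, hg⟩ := QuotientGroup.mk_surjective (s := commutator _) z.toMul
    obtain ⟨p, rfl⟩ := Path.Homotopic.Quotient.mk_surjective g
    have hz : z = ab.val p := by
      rw [hab]; exact congrArg Additive.ofMul hg.symm
    rw [hz, key]
  let e : H ≃+ FreeAbelianGroup K :=
    { θ with invFun := sg, left_inv := h3, right_inv := h2 }
  exact ⟨AddEquiv.toMultiplicativeRight e⟩

end PF

end GraphBraid


set_option linter.unusedSectionVars false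

open unitInterval Topology

namespace GraphBraid

namespace RTree

variable {N : Type} (T : RTree N)

/-- Clamping to the unit interval. -/
noncomputable def clamp (s : ℝ) : ℝ := max 0 (min s 1)

lemma clamp_continuous : Continuous clamp := by unfold clamp; fun_prop

lemma clamp_of_nonpos {s : ℝ} (h : s ≤ 0) : clamp s = 0 := by
  unfold clamp; rw [max_eq_left]; exact (min_le_left _ _).trans h

lemma clamp_pos {s : ℝ} : 0 < clamp s ↔ 0 < s := by
  unfold clamp; simp [lt_max_iff]

lemma clamp_mono : Monotone clamp := by
  intro a b h; unfold clamp; gcongr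

open Classical in
/-- Coordinates of the point at height `s` on the arc of `b`. -/
noncomputable def ray (b : N) (s : ℝ) (e : N) : ℝ :=
  if T.Anc e b then clamp (s - T.depth e) else 0

lemma ray_anc {v b : N} (h : T.Anc v b) {s : ℝ} (hs : s ≤ T.depth v + 1) :
    T.ray b s = T.ray v s := by
  funext e
  unfold ray
  by_cases h1 : T.Anc e v
  · rw [if_pos h1, if_pos (T.anc_trans h1 h)]
  · rw [if_neg h1]
    split_ifs with h2
    · apply clamp_of_nonpos
      have : T.depth v + 1 ≤ T.depth e := by
        by_contra h3
        exact h1 (T.anc_total h2 h (by omega))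
      have : (T.depth v : ℝ) + 1 ≤ T.depth e := by exact_mod_cast this
      linarith
    · rfl

/-- The model of the geometric realization. -/
def Y : Type := {y : ℝ × (N → ℝ) // ∃ b, 0 ≤ y.1 ∧ y.1 ≤ T.depth b + 1 ∧ y.2 = T.ray b y.1}

instance : TopologicalSpace T.Y := inferInstanceAs (TopologicalSpace (Subtype _))
instance : T2Space T.Y := inferInstanceAs (T2Space (Subtype _))

variable {T}

/-- Height of a point. -/
def ht (y : T.Y) : ℝ := y.1.1

lemma ht_continuous : Continuous (ht : T.Y → ℝ) := continuous_fst.comp continuous_subtype_val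

/-- Coordinates of a point. -/
def co (y : T.Y) : N → ℝ := y.1.2

lemma co_continuous : Continuous (co : T.Y → N → ℝ) := continuous_snd.comp continuous_subtype_val

lemma Y_ext {y z : T.Y} (h : ht y = ht z) (h' : co y = co z) : y = z :=
  Subtype.ext (Prod.ext h h')

lemma ht_nonneg (y : T.Y) : 0 ≤ ht y := by
  obtain ⟨b, h1, h2, h3⟩ := y.2
  exact h1

/-- `y` lies on the arc of `b`. -/
def On (b : N) (y : T.Y) : Prop := ht y ≤ T.depth b + 1 ∧ co y = T.ray b (ht y)

/-- `y` lies on the half open edge `v`. -/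
def IsCell (v : N) (y : T.Y) : Prop := On v y ∧ (v = T.root ∨ (T.depth v : ℝ) < ht y)

lemma exists_cell (y : T.Y) : ∃ v, IsCell v y := by
  obtain ⟨b, h1, h2, h3⟩ := y.2
  have h : On b y := ⟨h2, h3⟩
  clear h1 h2 h3
  induction b using T.depth_ind with
  | h0 => exact ⟨_, h, Or.inl rfl⟩
  | h b hb ih =>
    by_cases hd : (T.depth b : ℝ) < ht y
    · exact ⟨b, h, Or.inr hd⟩
    · have hs : ht y ≤ T.depth (T.par b) + 1 := by
        have := T.depth_par b hb
        have : (T.depth b : ℝ) = T.depth (T.par b) + 1 := by exact_mod_cast this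
        linarith
      exact ih ⟨hs, h.2.trans (T.ray_anc (T.anc_par b) hs)⟩

lemma IsCell.anc {v b : N} {y : T.Y} (h : IsCell v y) (h' : On b y) : T.Anc v b := by
  rcases h.2 with h0 | h0
  · rw [h0]; exact T.root_anc b
  · by_contra hn
    have h1 : co y v = clamp (ht y - T.depth v) := by
      rw [h.1.2, ray, if_pos (T.anc_refl v)]
    have h2 : co y v = 0 := by rw [h'.2, ray, if_neg hn]
    have h3 : 0 < clamp (ht y - T.depth v) := clamp_pos.2 (by linarith)
    linarith

lemma IsCell.unique {v u : N} {y : T.Y} (h : IsCell v y) (h' : IsCell u y) : v = u :=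
  T.anc_antisymm (h.anc h'.1) (h'.anc h.1)

/-- The edge containing `y`. -/
noncomputable def cell (y : T.Y) : N := (exists_cell y).choose

lemma cell_spec (y : T.Y) : IsCell (cell y) y := (exists_cell y).choose_spec

lemma cell_eq {v : N} {y : T.Y} (h : IsCell v y) : cell y = v := (cell_spec y).unique h

lemma on_iff {b : N} {y : T.Y} : On b y ↔ T.Anc (cell y) b := by
  refine ⟨fun h => (cell_spec y).anc h, fun h => ?_⟩
  obtain ⟨⟨h1, h2⟩, -⟩ := cell_spec y
  refine ⟨?_, h2.trans (T.ray_anc h h1).symm⟩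
  have : (T.depth (cell y) : ℝ) ≤ T.depth b := by exact_mod_cast T.anc_depth h
  linarith

lemma ht_le (y : T.Y) : ht y ≤ T.depth (cell y) + 1 := (cell_spec y).1.1

lemma lt_ht {y : T.Y} (h : cell y ≠ T.root) : (T.depth (cell y) : ℝ) < ht y :=
  (cell_spec y).2.resolve_left h

lemma depth_le_ht (y : T.Y) : (T.depth (cell y) : ℝ) ≤ ht y := by
  by_cases h : cell y = T.root
  · rw [h, T.depth_root]; simpa using ht_nonneg y
  · exact (lt_ht h).le

lemma On.eq {b : N} {y z : T.Y} (h : On b y) (h' : On b z) (e : ht y = ht z) : y = z :=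
  Y_ext e (by rw [h.2, h'.2, e])

/-- Comparison of cells by heights on an arc. -/
lemma depth_cell_le {y z : T.Y} (h : ht y ≤ ht z) : T.depth (cell y) ≤ T.depth (cell z) := by
  by_contra hn
  have hr : cell y ≠ T.root := by
    intro hr; rw [hr, T.depth_root] at hn; omega
  have h1 := lt_ht hr
  have h2 := ht_le z
  have h3 : (T.depth (cell z) : ℝ) + 1 ≤ T.depth (cell y) := by exact_mod_cast (by omega)
  linarith

lemma cell_anc {b : N} {y z : T.Y} (hy : On b y) (hz : On b z) (h : ht y ≤ ht z) :
    T.Anc (cell y) (cell z) :=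
  T.anc_total (on_iff.1 hy) (on_iff.1 hz) (depth_cell_le h)

variable (T)

/-- The point at height `s` (clamped) on the arc of `b`. -/
noncomputable def pt (b : N) (s : ℝ) : T.Y :=
  ⟨(max 0 (min s (T.depth b + 1)), T.ray b (max 0 (min s (T.depth b + 1)))),
    b, le_max_left _ _, max_le (by positivity) (min_le_right _ _), rfl⟩

lemma pt_on (b : N) (s : ℝ) : On b (T.pt b s) :=
  ⟨max_le (by positivity) (min_le_right _ _), rfl⟩

lemma ht_pt {b : N} {s : ℝ} (h0 : 0 ≤ s) (h1 : s ≤ T.depth b + 1) : ht (T.pt b s) = s := by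
  show max 0 (min s (T.depth b + 1)) = s
  rw [min_eq_left h1, max_eq_right h0]

lemma pt_continuous (b : N) : Continuous (T.pt b) := by
  apply Continuous.subtype_mk
  have h : Continuous fun s : ℝ => max 0 (min s ((T.depth b : ℝ) + 1)) := by fun_prop
  refine h.prodMk (continuous_pi fun e => ?_)
  unfold ray
  split_ifs
  · exact clamp_continuous.comp (h.sub continuous_const)
  · exact continuous_const

variable {T}

lemma On.pt_eq {b : N} {y : T.Y} (h : On b y) : T.pt b (ht y) = y :=
  (T.pt_on b _).eq h (T.ht_pt (ht_nonneg y) h.1)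

lemma cell_pt {v b : N} (hv : T.Anc v b) {s : ℝ} (h0 : (T.depth v : ℝ) < s) (h1 : s ≤ T.depth v + 1) :
    cell (T.pt b s) = v := by
  have hd : (T.depth v : ℝ) ≤ T.depth b := by exact_mod_cast T.anc_depth hv
  have hs : ht (T.pt b s) = s := T.ht_pt (by linarith [(T.depth v).cast_nonneg (α := ℝ)]) (by linarith)
  refine cell_eq ⟨⟨by rw [hs]; exact h1, ?_⟩, Or.inr (by rw [hs]; exact h0)⟩
  rw [(T.pt_on b s).2, hs, T.ray_anc hv h1]

/-! ### Stars -/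

/-- A star shaped neighbourhood of `x`. -/
def star (x : T.Y) (ε : ℝ) : Set T.Y :=
  {y | |ht y - ht x| < ε ∧ (cell x ≠ T.root → 0 < co y (cell x))}

/-- Admissible radii. -/
def Rad (x : T.Y) (ε : ℝ) : Prop :=
  0 < ε ∧ ε ≤ 1 ∧ (ht x < T.depth (cell x) + 1 → ε ≤ T.depth (cell x) + 1 - ht x)

lemma exists_rad (x : T.Y) : ∃ ε, Rad x ε := by
  by_cases h : ht x < T.depth (cell x) + 1
  · exact ⟨min 1 (T.depth (cell x) + 1 - ht x), lt_min one_pos (by linarith), min_le_left _ _,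
      fun _ => min_le_right _ _⟩
  · exact ⟨1, one_pos, le_rfl, fun h' => absurd h' h⟩

lemma Rad.mono {x : T.Y} {ε δ : ℝ} (h : Rad x ε) (h0 : 0 < δ) (h1 : δ ≤ ε) : Rad x δ :=
  ⟨h0, h1.trans h.2.1, fun hx => h1.trans (h.2.2 hx)⟩

lemma co_cell_pos {v b : N} {y : T.Y} (h : On b y) : 0 < co y v ↔ T.Anc v b ∧ (T.depth v : ℝ) < ht y := by
  rw [h.2, ray]
  split_ifs with h1
  · rw [clamp_pos]; simp [h1]
  · simp [h1]

lemma star_open (x : T.Y) (ε : ℝ) : IsOpen (star x ε) := by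
  have h1 : IsOpen {y : T.Y | |ht y - ht x| < ε} :=
    isOpen_lt ((ht_continuous.sub continuous_const).abs) continuous_const
  have h2 : IsOpen {y : T.Y | cell x ≠ T.root → 0 < co y (cell x)} := by
    by_cases h : cell x = T.root
    · simp [h]
    · simp only [ne_eq, h, not_false_eq_true, forall_const]
      exact isOpen_lt continuous_const ((continuous_apply _).comp co_continuous)
  exact h1.inter h2

lemma mem_star_self {x : T.Y} {ε : ℝ} (h : 0 < ε) : x ∈ star x ε := by
  refine ⟨by simpa using h, fun hr => ?_⟩
  rw [co_cell_pos (cell_spec x).1]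
  exact ⟨T.anc_refl _, lt_ht hr⟩

lemma star_anc {x y : T.Y} {ε : ℝ} (hy : y ∈ star x ε) : T.Anc (cell x) (cell y) := by
  by_cases hr : cell x = T.root
  · rw [hr]; exact T.root_anc _
  · exact ((co_cell_pos (cell_spec y).1).1 (hy.2 hr)).1

lemma star_cell {x y : T.Y} {ε : ℝ} (h : Rad x ε) (hy : y ∈ star x ε) :
    cell y = cell x ∨ (cell y ≠ T.root ∧ T.par (cell y) = cell x ∧
      ht x = T.depth (cell x) + 1) := by
  have ha := star_anc hy
  have hh := abs_lt.1 hy.1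
  by_cases he : cell x = cell y
  · exact Or.inl he.symm
  · right
    obtain ⟨s, h1, h2, h3⟩ := T.exists_child ha he
    have hd := T.depth_par s h1
    have hd' := T.anc_depth h3
    have hyr : cell y ≠ T.root := by
      intro hyr; rw [hyr, T.depth_root] at hd'; omega
    have h4 := lt_ht hyr
    have h6 : (T.depth (cell x) : ℝ) + 1 ≤ T.depth (cell y) := by
      rw [← h2]; exact_mod_cast (by omega)
    have hx : ht x = T.depth (cell x) + 1 := by
      by_contra hne
      have := h.2.2 (lt_of_le_of_ne (ht_le x) hne)
      linarith
    have h5 : (T.depth (cell y) : ℝ) < T.depth (cell x) + 2 := by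
      have := h.2.1; linarith
    have h7 : T.depth (cell y) < T.depth (cell x) + 2 := by exact_mod_cast h5
    have : s = cell y := T.anc_eq_of_depth h3 (by rw [hd, h2]; omega)
    rw [← this]
    exact ⟨h1, h2, hx⟩

lemma star_on {x y : T.Y} {ε : ℝ} (hy : y ∈ star x ε) : On (cell y) x := on_iff.2 (star_anc hy)

/-- Points between `y` and `x` are in the star. -/
lemma star_between {x y z : T.Y} {ε : ℝ} (h : 0 < ε) (hy : y ∈ star x ε) (hz : On (cell y) z)
    (hb : ht z ∈ Set.uIcc (ht y) (ht x)) : z ∈ star x ε := by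
  refine ⟨lt_of_le_of_lt ?_ hy.1, fun hr => ?_⟩
  · rcases Set.mem_uIcc.1 hb with hb | hb
    · rw [abs_of_nonpos (by linarith), abs_of_nonpos (by linarith)]; linarith
    · rw [abs_of_nonneg (by linarith), abs_of_nonneg (by linarith)]; linarith
  · rw [co_cell_pos hz]
    refine ⟨star_anc hy, ?_⟩
    have h1 := lt_ht hr
    have h2 := ((co_cell_pos (cell_spec y).1).1 (hy.2 hr)).2
    rcases Set.mem_uIcc.1 hb with hb | hb
    · exact lt_of_lt_of_le h2 hb.1
    · exact lt_of_lt_of_le h1 hb.1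

lemma star_disjoint {x x' y : T.Y} {ε : ℝ} (hy : y ∈ star x ε) (hy' : y ∈ star x' ε)
    (h : ht x ≠ ht x' → 2 * ε ≤ |ht x - ht x'|) : x = x' := by
  by_cases e : ht x = ht x'
  · exact (star_on hy).eq (star_on hy') e
  · have := h e
    have h1 := hy.1
    have h2 := hy'.1
    have : |ht x - ht x'| ≤ |ht y - ht x| + |ht y - ht x'| := by
      rw [abs_sub_comm (ht y) (ht x)]
      exact abs_sub_le _ _ _
    linarith

lemma clamp_nonneg (s : ℝ) : 0 ≤ clamp s := le_max_left _ _

/-- The contraction of a star. -/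
lemma star_contract (x : T.Y) {ε : ℝ} (h : 0 < ε) :
    ∃ H : I × star x ε → star x ε, Continuous H ∧ (∀ y, H (0, y) = y) ∧
      ∀ y, H (1, y) = ⟨x, mem_star_self h⟩ := by
  have key : ∀ p : I × star x ε, (fun e => max
      (min (co p.2.1 e) (clamp ((1 - p.1) * ht p.2.1 + p.1 * ht x - T.depth e)))
      (min (co x e) (clamp ((1 - p.1) * ht p.2.1 + p.1 * ht x - T.depth e)))) =
      T.ray (cell p.2.1) ((1 - p.1) * ht p.2.1 + p.1 * ht x) := by
    rintro ⟨⟨t, h0, h1⟩, y, hy⟩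
    funext e
    simp only
    rw [(cell_spec y).1.2, (star_on hy).2]
    unfold ray
    split_ifs with ha
    · rcases le_total (ht y) (ht x) with hl | hl
      · have : clamp ((1 - t) * ht y + t * ht x - T.depth e) ≤ clamp (ht x - T.depth e) :=
          clamp_mono (by nlinarith)
        rw [min_eq_right this]
        exact max_eq_right (min_le_right _ _)
      · have : clamp ((1 - t) * ht y + t * ht x - T.depth e) ≤ clamp (ht y - T.depth e) :=
          clamp_mono (by nlinarith)
        rw [min_eq_right this]
        exact max_eq_left (min_le_right _ _)
    · have := clamp_nonneg ((1 - t) * ht y + t * ht x - T.depth e)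
      rw [min_eq_left this, max_self]
  have hs : ∀ p : I × star x ε, (1 - p.1) * ht p.2.1 + p.1 * ht x ∈
      Set.uIcc (ht p.2.1) (ht x) := by
    rintro ⟨⟨t, h0, h1⟩, y, hy⟩
    simp only
    rw [Set.mem_uIcc]
    rcases le_total (ht y) (ht x) with hl | hl
    · left; constructor <;> nlinarith
    · right; constructor <;> nlinarith
  have hon : ∀ p : I × star x ε, 0 ≤ (1 - (p.1 : ℝ)) * ht p.2.1 + p.1 * ht x ∧
      (1 - (p.1 : ℝ)) * ht p.2.1 + p.1 * ht x ≤ T.depth (cell p.2.1) + 1 := by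
    intro p
    have := hs p
    have h1 := ht_nonneg x
    have h2 := ht_nonneg p.2.1
    have h3 := ht_le p.2.1
    have h4 := (star_on p.2.2).1
    rcases Set.mem_uIcc.1 this with hb | hb <;> constructor <;> linarith
  let H₀ : I × star x ε → T.Y := fun p => ⟨((1 - p.1) * ht p.2.1 + p.1 * ht x, fun e => max
      (min (co p.2.1 e) (clamp ((1 - p.1) * ht p.2.1 + p.1 * ht x - T.depth e)))
      (min (co x e) (clamp ((1 - p.1) * ht p.2.1 + p.1 * ht x - T.depth e)))),
      cell p.2.1, (hon p).1, (hon p).2, key p⟩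
  have hH₀ : ∀ p, On (cell p.2.1) (H₀ p) := fun p => ⟨(hon p).2, key p⟩
  have hc : Continuous H₀ := by
    apply Continuous.subtype_mk
    have h1 : Continuous fun p : I × star x ε => ht p.2.1 :=
      ht_continuous.comp (continuous_subtype_val.comp continuous_snd)
    have h2 : Continuous fun p : I × star x ε => (1 - (p.1 : ℝ)) * ht p.2.1 + p.1 * ht x := by
      fun_prop
    refine h2.prodMk (continuous_pi fun e => ?_)
    have h3 : Continuous fun p : I × star x ε => co p.2.1 e :=
      (continuous_apply e).comp (co_continuous.comp (continuous_subtype_val.comp continuous_snd))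
    have h4 : Continuous fun p : I × star x ε =>
        clamp ((1 - (p.1 : ℝ)) * ht p.2.1 + p.1 * ht x - T.depth e) :=
      clamp_continuous.comp (h2.sub continuous_const)
    exact (h3.min h4).max (continuous_const.min h4)
  refine ⟨fun p => ⟨H₀ p, star_between h p.2.2 (hH₀ p) (hs p)⟩, hc.subtype_mk _, ?_, ?_⟩
  · intro y
    apply Subtype.ext
    refine (hH₀ (0, y)).eq (cell_spec y.1).1 ?_
    show (1 - ((0 : I) : ℝ)) * ht y.1 + ((0 : I) : ℝ) * ht x = ht y.1
    simp
  · intro y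
    apply Subtype.ext
    refine (hH₀ (1, y)).eq (star_on y.2) ?_
    show (1 - ((1 : I) : ℝ)) * ht y.1 + ((1 : I) : ℝ) * ht x = ht x
    simp

end RTree

/-- Contractibility from an explicit contraction. -/
lemma contractible_of {S : Type} [TopologicalSpace S] (x : S) (H : I × S → S) (hc : Continuous H)
    (h0 : ∀ y, H (0, y) = y) (h1 : ∀ y, H (1, y) = x) : ContractibleSpace S := by
  rw [contractible_iff_id_nullhomotopic]
  exact ⟨x, ⟨⟨⟨H, hc⟩, h0, h1⟩⟩⟩

/-- A product of stars is contractible. -/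
lemma RTree.stars_contractible {N : Type} {T : RTree N} {ι : Type} (x : ι → T.Y) {ε : ℝ} (h : 0 < ε) :
    ContractibleSpace (∀ i, star (x i) ε) := by
  choose H hc h0 h1 using fun i => star_contract (x i) h
  refine contractible_of (fun i => ⟨x i, mem_star_self h⟩) (fun p i => H i (p.1, p.2 i)) ?_ ?_ ?_
  · exact continuous_pi fun i => (hc i).comp (continuous_fst.prodMk
      ((continuous_apply i).comp continuous_snd))
  · intro y; funext i; exact h0 i _
  · intro y; funext i; exact h1 i _

end GraphBraid


set_option linter.unusedSectionVars false

open unitInterval Topology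

namespace GraphBraid

namespace RTree

variable {N : Type} {T : RTree N} {n : ℕ}

variable (T n) in
/-- Ordered configurations in the model. -/
abbrev Cf : Type := {f : Fin n → T.Y // Function.Injective f}

variable (T n) in
/-- Unordered configurations in the model. -/
abbrev UX : Type := UConf n T.Y

variable (T n) in
/-- The projection to unordered configurations. -/
def qm : C(Cf T n, UX T n) := ⟨Quot.mk _, continuous_quot_mk⟩

/-- Permuting an ordered configuration. -/
def perm (x : Cf T n) (π : Equiv.Perm (Fin n)) : Cf T n := ⟨x.1 ∘ π, x.2.comp π.injective⟩

lemma qm_perm (x : Cf T n) (π : Equiv.Perm (Fin n)) : qm T n (perm x π) = qm T n x :=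
  (Quot.sound ⟨π, rfl⟩).symm

lemma perm_continuous (π : Equiv.Perm (Fin n)) : Continuous fun x : Cf T n => perm x π := by
  apply Continuous.subtype_mk
  exact continuous_pi fun i => (continuous_apply (π i)).comp continuous_subtype_val

lemma perm_perm (x : Cf T n) (π τ : Equiv.Perm (Fin n)) : perm (perm x π) τ = perm x (π * τ) := rfl

lemma qm_eq {x y : Cf T n} : qm T n x = qm T n y ↔ ∃ π, perm x π = y := by
  have he : Equivalence (PermRel n T.Y) := by
    refine ⟨fun x => ⟨1, rfl⟩, ?_, ?_⟩
    · rintro x y ⟨p, hp⟩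
      refine ⟨p⁻¹, ?_⟩
      rw [← hp]; funext i; simp
    · rintro x y z ⟨p, hp⟩ ⟨r, hr⟩
      exact ⟨p * r, by rw [← hr, ← hp]; rfl⟩
  constructor
  · intro h
    obtain ⟨p, hp⟩ := (Quot.eqvGen_exact h : Relation.EqvGen _ x y) |> he.eqvGen_iff.1
    exact ⟨p, Subtype.ext hp⟩
  · rintro ⟨p, rfl⟩; exact (qm_perm x p).symm

/-- The state of a configuration. -/
noncomputable def st (x : Cf T n) : Multiset N := Finset.univ.val.map (fun i => cell (x.1 i))

lemma st_card (x : Cf T n) : (st x).card = n := by simp [st]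

lemma st_perm (x : Cf T n) (π : Equiv.Perm (Fin n)) : st (perm x π) = st x := by
  unfold st perm
  conv_rhs => rw [← Multiset.map_univ_val_equiv π, Multiset.map_map]
  rfl

variable (T) in
/-- Admissible coarsenings of the set of edges: classes are chains. -/
structure Chain (B : N → N) : Prop where
  up : ∀ v, T.Anc v (B v)
  conv : ∀ v u, T.Anc v u → T.Anc u (B v) → B u = B v

/-- Being in the same convex region. -/
def Rel (B : N → N) (x y : Cf T n) : Prop :=
  (∀ i, B (cell (x.1 i)) = B (cell (y.1 i))) ∧
  ∀ i j, B (cell (x.1 i)) = B (cell (x.1 j)) → ht (x.1 i) < ht (x.1 j) → ht (y.1 i) < ht (y.1 j)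

lemma Chain.on {B : N → N} (hB : T.Chain B) (y : T.Y) : On (B (cell y)) y := on_iff.2 (hB.up _)

lemma Chain.on' {B : N → N} (hB : T.Chain B) {y : T.Y} {b : N} (h : B (cell y) = b) : On b y :=
  h ▸ hB.on y

lemma Chain.between {B : N → N} (hB : T.Chain B) {y z : T.Y} {b : N} (h : B (cell y) = b)
    (hz : On b z) (hl : ht y ≤ ht z) : B (cell z) = b := by
  rw [← h]
  exact hB.conv _ _ (cell_anc (hB.on' h) hz hl) (h ▸ on_iff.1 hz)

lemma Chain.ht_ne {B : N → N} (hB : T.Chain B) (x : Cf T n) {i j : Fin n} (hij : i ≠ j)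
    (h : B (cell (x.1 i)) = B (cell (x.1 j))) : ht (x.1 i) ≠ ht (x.1 j) := fun he =>
  hij (x.2 ((hB.on' h).eq (hB.on _) he))

lemma Rel.refl {B : N → N} (x : Cf T n) : Rel B x x := ⟨fun _ => rfl, fun _ _ _ h => h⟩

lemma Rel.trans {B : N → N} {x y z : Cf T n} (h : Rel B x y) (h' : Rel B y z) : Rel B x z :=
  ⟨fun i => (h.1 i).trans (h'.1 i), fun i j hij hl =>
    h'.2 i j (by rw [← h.1, ← h.1, hij]) (h.2 i j hij hl)⟩

lemma Rel.symm {B : N → N} (hB : T.Chain B) {x y : Cf T n} (h : Rel B x y) : Rel B y x := by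
  refine ⟨fun i => (h.1 i).symm, fun i j hij hl => ?_⟩
  have hij' : B (cell (x.1 i)) = B (cell (x.1 j)) := by rw [h.1, h.1, hij]
  have hne : i ≠ j := by rintro rfl; exact lt_irrefl _ hl
  rcases lt_or_gt_of_ne (hB.ht_ne x hne hij') with h1 | h1
  · exact h1
  · exact absurd (h.2 j i hij'.symm h1) (not_lt.2 hl.le)

lemma Rel.perm {B : N → N} {x y : Cf T n} (h : Rel B x y) (π : Equiv.Perm (Fin n)) :
    Rel B (perm x π) (perm y π) :=
  ⟨fun i => h.1 (π i), fun i j => h.2 (π i) (π j)⟩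

/-- The region of `x`. -/
def Cl (B : N → N) (x : Cf T n) : Type := {y : Cf T n // Rel B x y}

instance (B : N → N) (x : Cf T n) : TopologicalSpace (Cl B x) :=
  inferInstanceAs (TopologicalSpace (Subtype _))

lemma Cl_contractible {B : N → N} (hB : T.Chain B) (x : Cf T n) : ContractibleSpace (Cl B x) := by
  let b : Fin n → N := fun i => B (cell (x.1 i))
  let s : I × Cl B x → Fin n → ℝ := fun p i => (1 - (p.1 : ℝ)) * ht (p.2.1.1 i) + p.1 * ht (x.1 i)
  have hx : ∀ i, On (b i) (x.1 i) := fun i => hB.on _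
  have hy : ∀ (y : Cl B x) i, On (b i) (y.1.1 i) := fun y i => hB.on' (y.2.1 i).symm
  have hs0 : ∀ p i, min (ht (p.2.1.1 i)) (ht (x.1 i)) ≤ s p i := by
    rintro ⟨⟨t, h0, h1⟩, y⟩ i
    show _ ≤ (1 - t) * ht (y.1.1 i) + t * ht (x.1 i)
    rcases le_total (ht (y.1.1 i)) (ht (x.1 i)) with h | h
    · simp only [min_eq_left h]; nlinarith
    · simp only [min_eq_right h]; nlinarith
  have hs1 : ∀ p i, s p i ≤ T.depth (b i) + 1 := by
    rintro ⟨⟨t, h0, h1⟩, y⟩ i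
    show (1 - t) * ht (y.1.1 i) + t * ht (x.1 i) ≤ _
    have := (hx i).1
    have := (hy y i).1
    nlinarith
  have hht : ∀ p i, ht (T.pt (b i) (s p i)) = s p i := fun p i =>
    T.ht_pt ((le_min (ht_nonneg _) (ht_nonneg _)).trans (hs0 p i)) (hs1 p i)
  have hB' : ∀ p i, B (cell (T.pt (b i) (s p i))) = b i := by
    intro p i
    have h := hs0 p i
    rw [← hht p i] at h
    rcases min_le_iff.1 h with h | h
    · exact hB.between (p.2.2.1 i).symm (T.pt_on _ _) h
    · exact hB.between rfl (T.pt_on _ _) h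
  have hord : ∀ p i j, b i = b j → ht (x.1 i) < ht (x.1 j) → s p i < s p j := by
    rintro ⟨⟨t, h0, h1⟩, y⟩ i j hb hl
    show (1 - t) * ht (y.1.1 i) + t * ht (x.1 i) < (1 - t) * ht (y.1.1 j) + t * ht (x.1 j)
    have := y.2.2 i j hb hl
    rcases h0.lt_or_eq with h | h
    · nlinarith
    · rw [← h]; simpa using this
  let H : I × Cl B x → Cl B x := fun p => ⟨⟨fun i => T.pt (b i) (s p i), by
    intro i j hij
    simp only at hij
    by_contra hne
    have hb : b i = b j := by rw [← hB' p i, hij, hB' p j]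
    have he : s p i = s p j := by rw [← hht p i, hij, hht p j]
    rcases lt_or_gt_of_ne (hB.ht_ne x hne hb) with h | h
    · exact absurd he (hord p i j hb h).ne
    · exact absurd he (hord p j i hb.symm h).ne'⟩, fun i => (hB' p i).symm, fun i j hb hl => by
      simp only [hht]; exact hord p i j hb hl⟩
  have hval : ∀ (y : Cl B x) i, ht (y.1.1 i) = ht (y.1.1 i) := fun _ _ => rfl
  refine contractible_of (⟨x, Rel.refl x⟩ : Cl B x) H ?_ ?_ ?_
  · refine Continuous.subtype_mk (Continuous.subtype_mk (continuous_pi fun i => ?_) _) _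
    refine (T.pt_continuous _).comp ?_
    have h1 : Continuous fun p : I × Cl B x => ht (p.2.1.1 i) :=
      ht_continuous.comp ((continuous_apply i).comp (continuous_subtype_val.comp
        (continuous_subtype_val.comp continuous_snd)))
    show Continuous fun p : I × Cl B x => (1 - (p.1 : ℝ)) * ht (p.2.1.1 i) + p.1 * ht (x.1 i)
    fun_prop
  · intro y
    refine Subtype.ext (Subtype.ext (funext fun i => ?_))
    refine (T.pt_on _ _).eq (hy y i) ((hht _ _).trans ?_)
    show (1 - ((0 : I) : ℝ)) * ht (y.1.1 i) + ((0 : I) : ℝ) * ht (x.1 i) = _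
    simp
  · intro y
    refine Subtype.ext (Subtype.ext (funext fun i => ?_))
    refine (T.pt_on _ _).eq (hx i) ((hht _ _).trans ?_)
    show (1 - ((1 : I) : ℝ)) * ht (y.1.1 i) + ((1 : I) : ℝ) * ht (x.1 i) = _
    simp

section

variable {A : Type} [AddCommGroup A] (ψ : PF (UX T n) A)

/-- Value of the functional on a path of ordered configurations. -/
def qv {x y : Cf T n} (p : Path x y) : A := ψ.val (p.map (qm T n).continuous)

lemma qv_trans {x y z : Cf T n} (p : Path x y) (p' : Path y z) :
    qv ψ (p.trans p') = qv ψ p + qv ψ p' := by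
  unfold qv; rw [Path.map_trans, ψ.val_trans]

lemma qv_perm {x y : Cf T n} (p : Path x y) (π : Equiv.Perm (Fin n)) :
    qv ψ (p.map (perm_continuous π)) = qv ψ p := by
  unfold qv
  rw [← ψ.val_cast (p.map (qm T n).continuous) (qm_perm x π) (qm_perm y π)]
  congr 1
  ext t
  exact qm_perm _ _

lemma Rel.path {B : N → N} (hB : T.Chain B) {x y : Cf T n} (h : Rel B x y) :
    ∃ p : Path x y, ∀ t, Rel B x (p t) := by
  have := Cl_contractible hB x
  let p : Path (⟨x, Rel.refl x⟩ : Cl B x) (⟨y, h⟩ : Cl B x) :=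
    PathConnectedSpace.somePath (X := Cl B x) _ _
  exact ⟨p.map (f := fun z : Cl B x => z.1) continuous_subtype_val, fun t => (p t).2⟩

lemma qv_unique {B : N → N} (hB : T.Chain B) {x y : Cf T n} (p p' : Path x y)
    (hp : ∀ t, Rel B x (p t)) (hp' : ∀ t, Rel B x (p' t)) : qv ψ p = qv ψ p' := by
  have := Cl_contractible hB x
  have hy : Rel B x y := by have := hp 1; rwa [p.target] at this
  let F : C(Cl B x, Cf T n) := ⟨fun z => z.1, continuous_subtype_val⟩
  let P : Path (⟨x, Rel.refl x⟩ : Cl B x) ⟨y, hy⟩ :=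
    ⟨⟨fun t => ⟨p t, hp t⟩, p.continuous.subtype_mk _⟩, Subtype.ext p.source, Subtype.ext p.target⟩
  let P' : Path (⟨x, Rel.refl x⟩ : Cl B x) ⟨y, hy⟩ :=
    ⟨⟨fun t => ⟨p' t, hp' t⟩, p'.continuous.subtype_mk _⟩, Subtype.ext p'.source,
      Subtype.ext p'.target⟩
  have h1 := ψ.ev_eq ((qm T n).comp F) P
  have h2 := ψ.ev_eq ((qm T n).comp F) P'
  exact h1.trans h2.symm

lemma Rel.perm_eq {B : N → N} (hB : T.Chain B) {x : Cf T n} {τ : Equiv.Perm (Fin n)}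
    (h : Rel B x (RTree.perm x τ)) : τ = 1 := by
  have aux : ∀ (τ : Equiv.Perm (Fin n)), Rel B x (RTree.perm x τ) → ∀ i,
      ¬ ht (x.1 i) < ht (x.1 (τ i)) := by
    intro τ h i hi
    have hcell : ∀ k : ℕ, B (cell (x.1 ((τ ^ k) i))) = B (cell (x.1 i)) := by
      intro k
      induction k with
      | zero => rfl
      | succ k ih => rw [pow_succ', Equiv.Perm.mul_apply, ← ih]; exact (h.1 _).symm
    have hlt : ∀ k : ℕ, ht (x.1 ((τ ^ k) i)) < ht (x.1 ((τ ^ (k+1)) i)) := by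
      intro k
      induction k with
      | zero => simpa using hi
      | succ k ih =>
        have := h.2 _ _ ((hcell k).trans (hcell (k+1)).symm) ih
        rw [pow_succ' τ (k+1), pow_succ' τ k]
        rw [pow_succ' τ k] at this
        exact this
    have hm : StrictMono fun k : ℕ => ht (x.1 ((τ ^ k) i)) := strictMono_nat_of_lt_succ hlt
    have hinj : Function.Injective fun k : ℕ => (τ ^ k) i := fun a b hab =>
      hm.injective (by simp only at hab; simp only [hab])
    exact not_injective_infinite_finite _ hinj
  apply Equiv.ext
  intro i
  by_contra hne
  rcases lt_or_gt_of_ne (hB.ht_ne x hne (h.1 i).symm) with h1 | h1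
  · have h2 : Rel B x (RTree.perm x τ⁻¹) := by
      have := (h.symm hB).perm τ⁻¹
      rwa [perm_perm, mul_inv_cancel] at this
    refine aux _ h2 (τ i) ?_
    simpa using h1
  · exact aux τ h i h1

open Classical in
/-- Value of the functional inside a region. -/
noncomputable def W (B : N → N) (x y : Cf T n) : A :=
  if h : ∃ (π : Equiv.Perm (Fin n)) (p : Path x (perm y π)), ∀ t, Rel B x (p t) then
    qv ψ h.choose_spec.choose else 0

lemma W_eq {B : N → N} (hB : T.Chain B) {x y : Cf T n} (π : Equiv.Perm (Fin n))
    (p : Path x (perm y π)) (hp : ∀ t, Rel B x (p t)) : W ψ B x y = qv ψ p := by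
  have h : ∃ (π : Equiv.Perm (Fin n)) (p : Path x (perm y π)), ∀ t, Rel B x (p t) := ⟨π, p, hp⟩
  rw [W, dif_pos h]
  have h1 := h.choose_spec.choose_spec
  generalize h.choose_spec.choose = p' at h1
  generalize h.choose = π' at p' h1
  have e : π = π' := by
    have r1 : Rel B x (perm y π) := by have := hp 1; rwa [p.target] at this
    have r2 : Rel B x (perm y π') := by have := h1 1; rwa [p'.target] at this
    have r3 := (r1.symm hB).trans r2
    have r4 : perm y π' = perm (perm y π) (π⁻¹ * π') := by
      rw [perm_perm, mul_inv_cancel_left]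
    rw [r4] at r3
    have := r3.perm_eq hB
    rwa [inv_mul_eq_one] at this
  subst e
  exact qv_unique ψ hB _ _ h1 hp

end

lemma exists_perm [LinearOrder N] {B : N → N} (hB : T.Chain B) {x y : Cf T n}
    (h : (st x).map B = (st y).map B) : ∃ π, Rel B x (perm y π) := by
  let k : Cf T n → Fin n → N ×ₗ ℝ := fun x i => toLex (B (cell (x.1 i)), ht (x.1 i))
  let s : Cf T n → Equiv.Perm (Fin n) := fun x => Tuple.sort (k x)
  have hm : ∀ x, Monotone (k x ∘ s x) := fun x => Tuple.monotone_sort _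
  let f : Cf T n → Fin n → N := fun x i => B (cell (x.1 i))
  have hf : ∀ x, Monotone (f x ∘ s x) := fun x i j hij => by
    have := hm x hij
    rcases (Prod.Lex.le_iff).1 this with h | h
    · exact h.le
    · exact h.1.le
  have hst : ∀ x : Cf T n, (st x).map B = (List.ofFn (f x ∘ s x) : Multiset N) := by
    intro x
    rw [st, Multiset.map_map, Multiset.coe_eq_coe.2 (Equiv.Perm.ofFn_comp_perm (s x) (f x)),
      ← Fin.univ_val_map]
    rfl
  have he : f x ∘ s x = f y ∘ s y := by
    rw [hst, hst, Multiset.coe_eq_coe] at h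
    have := h.eq_of_pairwise' (List.pairwise_ofFn.2 fun i j hij => hf x hij.le)
      (List.pairwise_ofFn.2 fun i j hij => hf y hij.le)
    exact List.ofFn_injective this
  have hinv : ∀ i, s x ((s x)⁻¹ i) = i := fun i => by simp
  refine ⟨(s x)⁻¹.trans (s y), fun i => ?_, fun i j hij hl => ?_⟩
  · have := congrFun he ((s x)⁻¹ i)
    simp only [Function.comp_apply, hinv] at this
    exact this
  · have hab : (s x)⁻¹ i < (s x)⁻¹ j := by
      by_contra hn
      have := hm x (not_lt.1 hn)
      simp only [Function.comp_apply, hinv] at this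
      rcases (Prod.Lex.le_iff).1 this with h | h
      · exact absurd hij h.ne'
      · exact absurd hl (not_lt.2 h.2)
    have hb := hm y hab.le
    have e1 := congrFun he ((s x)⁻¹ i)
    have e2 := congrFun he ((s x)⁻¹ j)
    simp only [Function.comp_apply, hinv] at e1 e2
    have e3 : f y (s y ((s x)⁻¹ i)) = f y (s y ((s x)⁻¹ j)) := by rw [← e1, ← e2]; exact hij
    have hne : s y ((s x)⁻¹ i) ≠ s y ((s x)⁻¹ j) := fun e => hab.ne ((s y).injective e)
    refine lt_of_le_of_ne ?_ (hB.ht_ne y hne e3)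
    rcases (Prod.Lex.le_iff).1 hb with h | h
    · exact absurd e3 h.ne
    · exact h.2

lemma Rel.coarse {B B' : N → N} (hB : T.Chain B) (hB' : T.Chain B') (hc : ∀ v, B' (B v) = B' v)
    {x y : Cf T n} (h : Rel B x y) : Rel B' x y := by
  refine ⟨fun i => by rw [← hc, h.1, hc], fun i j hij hl => ?_⟩
  by_cases e : B (cell (x.1 i)) = B (cell (x.1 j))
  · exact h.2 i j e hl
  by_contra hn
  have hy : ∀ i, B' (cell (y.1 i)) = B' (cell (x.1 i)) := fun i => by rw [← hc, ← h.1, hc]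
  have h1 : T.Anc (cell (x.1 i)) (cell (x.1 j)) := cell_anc (hB'.on' hij) (hB'.on _) hl.le
  have h2 : T.Anc (cell (y.1 j)) (cell (y.1 i)) :=
    cell_anc (hB'.on' (b := B' (cell (x.1 j))) (hy j)) (hB'.on' ((hy i).trans hij)) (not_lt.1 hn)
  have h3 : T.Anc (B (cell (x.1 i))) (B' (cell (x.1 j))) := by
    have := hB'.up (B (cell (x.1 i))); rwa [hc, hij] at this
  have h4 : T.Anc (B (cell (x.1 j))) (B' (cell (x.1 j))) := by
    have := hB'.up (B (cell (x.1 j))); rwa [hc] at this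
  rcases le_total (T.depth (B (cell (x.1 i)))) (T.depth (B (cell (x.1 j)))) with hd | hd
  · have h5 := T.anc_total h3 h4 hd
    refine e ?_
    rw [h.1 i, h.1 j]
    rw [h.1 i, h.1 j] at h5
    exact hB.conv _ _ h2 (T.anc_trans (hB.up _) h5)
  · have h5 := T.anc_total h4 h3 hd
    exact e (hB.conv _ _ h1 (T.anc_trans (hB.up _) h5)).symm

section

variable [LinearOrder N] {A A' : Type} [AddCommGroup A] [AddCommGroup A'] (ψ : PF (UX T n) A)

lemma exists_W {B : N → N} (hB : T.Chain B) {x y : Cf T n} (h : (st x).map B = (st y).map B) :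
    ∃ (π : Equiv.Perm (Fin n)) (p : Path x (perm y π)), (∀ t, Rel B x (p t)) := by
  obtain ⟨π, hπ⟩ := exists_perm hB h
  obtain ⟨p, hp⟩ := hπ.path hB
  exact ⟨π, p, hp⟩

lemma W_add {B : N → N} (hB : T.Chain B) {x y z : Cf T n} (h : (st x).map B = (st y).map B)
    (h' : (st y).map B = (st z).map B) : W ψ B x y + W ψ B y z = W ψ B x z := by
  obtain ⟨π, p, hp⟩ := exists_W hB h
  obtain ⟨π', p', hp'⟩ := exists_W hB h'
  rw [W_eq ψ hB π p hp, W_eq ψ hB π' p' hp', ← qv_perm ψ p' π, ← qv_trans]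
  refine (W_eq ψ hB (π' * π) ((p.trans (p'.map (perm_continuous π))).cast rfl
    (perm_perm z π' π).symm) ?_).symm
  intro t
  have h1 : Rel B x (perm y π) := by have := hp 1; rwa [p.target] at this
  show Rel B x ((p.trans (p'.map (perm_continuous π))) t)
  rw [Path.trans_apply]
  split_ifs
  · exact hp _
  · exact h1.trans ((hp' _).perm π)

lemma W_self {B : N → N} (hB : T.Chain B) (x : Cf T n) : W ψ B x x = 0 := by
  have := W_add ψ hB (x := x) (y := x) (z := x) rfl rfl
  simpa using this

lemma W_perm {B : N → N} (hB : T.Chain B) (x : Cf T n) (π : Equiv.Perm (Fin n)) :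
    W ψ B (perm x π) x = 0 := by
  rw [W_eq ψ hB π (Path.refl (perm x π)) (fun _ => Rel.refl _)]
  exact ψ.val_refl _

lemma W_coarse {B B' : N → N} (hB : T.Chain B) (hB' : T.Chain B') (hc : ∀ v, B' (B v) = B' v)
    {x y : Cf T n} (h : (st x).map B = (st y).map B) : W ψ B' x y = W ψ B x y := by
  obtain ⟨π, p, hp⟩ := exists_W hB h
  rw [W_eq ψ hB π p hp, W_eq ψ hB' π p fun t => (hp t).coarse hB hB' hc]

lemma W_map {B : N → N} (hB : T.Chain B) (θ : A →+ A')
    {x y : Cf T n} (h : (st x).map B = (st y).map B) : W (ψ.map θ) B x y = θ (W ψ B x y) := by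
  obtain ⟨π, p, hp⟩ := exists_W hB h
  rw [W_eq _ hB π p hp, W_eq ψ hB π p hp]
  rfl

lemma W_sub {B : N → N} (hB : T.Chain B) (ψ' : PF (UX T n) A)
    {x y : Cf T n} (h : (st x).map B = (st y).map B) :
    W (ψ.sub ψ') B x y = W ψ B x y - W ψ' B x y := by
  obtain ⟨π, p, hp⟩ := exists_W hB h
  rw [W_eq _ hB π p hp, W_eq ψ hB π p hp, W_eq ψ' hB π p hp]
  rfl

lemma W_pot {B : N → N} (hB : T.Chain B) (g : UX T n → A)
    (hg : ∀ (a b : UX T n) (p : Path a b), ψ.val p = g b - g a)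
    {x y : Cf T n} (h : (st x).map B = (st y).map B) :
    W ψ B x y = g (qm T n y) - g (qm T n x) := by
  obtain ⟨π, p, hp⟩ := exists_W hB h
  rw [W_eq ψ hB π p hp, qv, hg, qm_perm]

end

end RTree

end GraphBraid


set_option linter.unusedSectionVars false

open unitInterval Topology

namespace GraphBraid

namespace RTree

variable {N : Type} {T : RTree N} {n : ℕ}

/-! ### Local structure -/

/-- Good radii for a configuration. -/
def Good (x : Cf T n) (ε : ℝ) : Prop :=
  (∀ i, Rad (x.1 i) ε) ∧
    ∀ i j, ht (x.1 i) ≠ ht (x.1 j) → 2 * ε ≤ |ht (x.1 i) - ht (x.1 j)|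

lemma exists_good (x : Cf T n) : ∃ ε, 0 < ε ∧ Good x ε := by
  have h1 : ∀ᶠ ε in 𝓝[>] (0 : ℝ), ∀ i, Rad (x.1 i) ε := by
    rw [Filter.eventually_all]
    intro i
    obtain ⟨δ, hδ⟩ := exists_rad (x.1 i)
    filter_upwards [Ioc_mem_nhdsGT hδ.1] with ε hε
    exact hδ.mono hε.1 hε.2
  have h2 : ∀ᶠ ε in 𝓝[>] (0 : ℝ), ∀ i j, ht (x.1 i) ≠ ht (x.1 j) →
      2 * ε ≤ |ht (x.1 i) - ht (x.1 j)| := by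
    rw [Filter.eventually_all]
    intro i
    rw [Filter.eventually_all]
    intro j
    by_cases h : ht (x.1 i) = ht (x.1 j)
    · simp [h]
    · have hp : 0 < |ht (x.1 i) - ht (x.1 j)| / 2 := by
        have := abs_pos.2 (sub_ne_zero.2 h); linarith
      filter_upwards [Ioc_mem_nhdsGT hp] with ε hε _
      have := hε.2
      linarith
  have h3 : ∀ᶠ ε in 𝓝[>] (0 : ℝ), 0 < ε := self_mem_nhdsWithin
  obtain ⟨ε, h⟩ := (h3.and (h1.and h2)).exists
  exact ⟨ε, h⟩

/-- A good radius. -/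
noncomputable def rad (x : Cf T n) : ℝ := (exists_good x).choose

lemma rad_pos (x : Cf T n) : 0 < rad x := (exists_good x).choose_spec.1

lemma rad_good (x : Cf T n) : Good x (rad x) := (exists_good x).choose_spec.2

lemma rad_disjoint (x : Cf T n) {i j : Fin n} {y : T.Y} (hi : y ∈ star (x.1 i) (rad x))
    (hj : y ∈ star (x.1 j) (rad x)) : i = j :=
  x.2 (star_disjoint hi hj ((rad_good x).2 i j))

/-- The product neighbourhood of a configuration. -/
abbrev Nb (x : Cf T n) : Type := ∀ i, star (x.1 i) (rad x)

instance (x : Cf T n) : SimplyConnectedSpace (Nb x) := by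
  have := stars_contractible x.1 (rad_pos x)
  infer_instance

/-- Inclusion of the product neighbourhood. -/
def inc (x : Cf T n) : C(Nb x, Cf T n) :=
  ⟨fun y => ⟨fun i => (y i).1, fun i j h => rad_disjoint x (y i).2 (by
    simp only at h; rw [h]; exact (y j).2)⟩, by
    apply Continuous.subtype_mk
    exact continuous_pi fun i => continuous_subtype_val.comp (continuous_apply i)⟩

/-- The centre. -/
noncomputable def ctr (x : Cf T n) : Nb x := fun i => ⟨x.1 i, mem_star_self (rad_pos x)⟩

lemma inc_ctr (x : Cf T n) : inc x (ctr x) = x := rfl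

lemma inc_emb (x : Cf T n) : IsOpenEmbedding (inc x) := by
  have h1 : IsEmbedding (inc x) := by
    refine IsEmbedding.of_comp (g := Subtype.val) (inc x).continuous continuous_subtype_val ?_
    exact IsEmbedding.piMap (fun i => IsEmbedding.subtypeVal)
  refine ⟨h1, ?_⟩
  have : Set.range (inc x) = ⋂ i, (fun z : Cf T n => z.1 i) ⁻¹' (star (x.1 i) (rad x)) := by
    ext z
    simp only [Set.mem_range, Set.mem_iInter, Set.mem_preimage]
    constructor
    · rintro ⟨y, rfl⟩ i; exact (y i).2
    · intro h; exact ⟨fun i => ⟨z.1 i, h i⟩, rfl⟩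
  rw [this]
  exact isOpen_iInter_of_finite fun i => (star_open _ _).preimage
    ((continuous_apply i).comp continuous_subtype_val)

lemma qm_open : IsOpenMap (qm T n) := by
  intro U hU
  have hq : IsQuotientMap (qm T n) := isQuotientMap_quot_mk
  rw [← hq.isOpen_preimage]
  have : qm T n ⁻¹' (qm T n '' U) = ⋃ π, (fun x => perm x π) ⁻¹' U := by
    ext x
    simp only [Set.mem_preimage, Set.mem_image, Set.mem_iUnion]
    constructor
    · rintro ⟨y, hy, h⟩
      obtain ⟨π, rfl⟩ := qm_eq.1 h.symm
      exact ⟨π, hy⟩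
    · rintro ⟨π, h⟩
      exact ⟨_, h, qm_perm _ _⟩
  rw [this]
  exact isOpen_iUnion fun π => hU.preimage (perm_continuous π)

/-- The product neighbourhood in the unordered configuration space. -/
def nbm (x : Cf T n) : C(Nb x, UX T n) := (qm T n).comp (inc x)

lemma nbm_emb (x : Cf T n) : IsOpenEmbedding (nbm x) := by
  refine .of_continuous_injective_isOpenMap (nbm x).continuous ?_ (qm_open.comp (inc_emb x).isOpenMap)
  intro y z h
  obtain ⟨π, hπ⟩ := qm_eq.1 h
  have e : ∀ i, (y (π i)).1 = (z i).1 := fun i => congrFun (congrArg Subtype.val hπ) i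
  have hi : ∀ i, π i = i := fun i => rad_disjoint x (y (π i)).2 (by rw [e]; exact (z i).2)
  funext i
  have := e i
  rw [hi] at this
  exact Subtype.ext this

section

variable {A : Type} [AddCommGroup A] (ψ : PF (UX T n) A)

lemma loc_val (x : Cf T n) {a b : UX T n} (p : Path a b) (hp : Set.range p ⊆ Set.range (nbm x))
    (s s' : Nb x) (ha : nbm x s = a) (hb : nbm x s' = b) : ψ.val p = ψ.ev (nbm x) s s' := by
  subst ha; subst hb
  let e := (nbm_emb x).isEmbedding.toHomeomorph
  let P : Path s s' := ⟨⟨fun t => e.symm ⟨p t, hp ⟨t, rfl⟩⟩,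
    e.symm.continuous.comp (p.continuous.subtype_mk _)⟩, by
      show e.symm _ = _
      rw [e.symm_apply_eq]; exact Subtype.ext p.source, by
      show e.symm _ = _
      rw [e.symm_apply_eq]; exact Subtype.ext p.target⟩
  rw [← ψ.ev_eq (nbm x) P]
  congr 1
  ext t
  exact (congrArg Subtype.val (e.apply_symm_apply ⟨p t, hp ⟨t, rfl⟩⟩)).symm

open Classical in
/-- Replacing a coordinate by that of the centre. -/
noncomputable def mv (x : Cf T n) (y : Nb x) (i : Fin n) : Nb x := Function.update y i (ctr x i)

lemma move_path {x : Cf T n} (y : Nb x) (i : Fin n) {B : N → N} (hB : T.Chain B)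
    (h : B (cell (y i).1) = B (cell (x.1 i))) :
    ∃ p : Path y (mv x y i), ∀ t, Rel B (inc x y) (inc x (p t)) := by
  classical
  have hon : On (cell (y i).1) (x.1 i) := star_on (y i).2
  let s : I → ℝ := fun t => (1 - (t : ℝ)) * ht (y i).1 + t * ht (x.1 i)
  have hs : ∀ t, s t ∈ Set.uIcc (ht (y i).1) (ht (x.1 i)) := by
    rintro ⟨t, h0, h1⟩
    show (1 - t) * ht (y i).1 + t * ht (x.1 i) ∈ _
    rw [Set.mem_uIcc]
    rcases le_total (ht (y i).1) (ht (x.1 i)) with hl | hl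
    · left; constructor <;> nlinarith
    · right; constructor <;> nlinarith
  have hht : ∀ t, ht (T.pt (cell (y i).1) (s t)) = s t := by
    intro t
    have h1 := ht_nonneg (x.1 i)
    have h2 := ht_nonneg (y i).1
    have h3 := ht_le (y i).1
    have h4 := hon.1
    apply T.ht_pt <;> rcases Set.mem_uIcc.1 (hs t) with hb | hb <;> linarith
  have hpt : ∀ t, On (cell (y i).1) (T.pt (cell (y i).1) (s t)) := fun t => T.pt_on _ _
  have hst : ∀ t, T.pt (cell (y i).1) (s t) ∈ star (x.1 i) (rad x) := fun t =>
    star_between (rad_pos x) (y i).2 (hpt t) (by rw [hht]; exact hs t)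
  let z : I → Nb x := fun t => Function.update y i ⟨T.pt (cell (y i).1) (s t), hst t⟩
  have hz : Continuous z := by
    refine continuous_const.update i (Continuous.subtype_mk ((T.pt_continuous _).comp ?_) _)
    show Continuous fun t : I => (1 - (t : ℝ)) * ht (y i).1 + t * ht (x.1 i)
    fun_prop
  have hz0 : z 0 = y := by
    have : (⟨T.pt (cell (y i).1) (s 0), hst 0⟩ : star (x.1 i) (rad x)) = y i :=
      Subtype.ext ((hpt 0).eq (cell_spec _).1 (by rw [hht]; simp [s]))
    simp only [z, this, Function.update_eq_self]
  have hz1 : z 1 = mv x y i := by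
    have : (⟨T.pt (cell (y i).1) (s 1), hst 1⟩ : star (x.1 i) (rad x)) = ctr x i :=
      Subtype.ext ((hpt 1).eq hon (by rw [hht]; simp [s, ctr]))
    simp only [z, this, mv]
  refine ⟨⟨⟨z, hz⟩, hz0, hz1⟩, fun t => ?_⟩
  show Rel B (inc x y) (inc x (z t))
  set b := B (cell (x.1 i)) with hb
  have hyb : On b (y i).1 := hB.on' h
  have hxb : On b (x.1 i) := hB.on _
  have hzb : On b (T.pt (cell (y i).1) (s t)) := by
    have h1 := on_iff.1 (hpt t)
    exact on_iff.2 (T.anc_trans h1 (on_iff.1 hyb))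
  have hBz : B (cell (T.pt (cell (y i).1) (s t))) = b := by
    rcases Set.mem_uIcc.1 (hs t) with hl | hl
    · exact hB.between h hzb (by rw [hht]; exact hl.1)
    · exact hB.between hb.symm hzb (by rw [hht]; exact hl.1)
  have zi : (z t i).1 = T.pt (cell (y i).1) (s t) := by simp [z]
  have zj : ∀ j, j ≠ i → z t j = y j := fun j hj => by simp [z, hj]
  have hno : ∀ j, j ≠ i → On (cell (y i).1) (y j).1 →
      ht (y j).1 ∉ Set.uIcc (ht (y i).1) (ht (x.1 i)) := fun j hj ho hm =>
    hj (rad_disjoint x (y j).2 (star_between (rad_pos x) (y i).2 ho hm))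
  have hlow : ∀ j, B (cell (y j).1) = b → (ht (y j).1 ≤ ht (y i).1 ∨ ht (y j).1 ≤ ht (x.1 i)) →
      On (cell (y i).1) (y j).1 := by
    intro j hj hl
    rcases hl with hl | hl
    · exact on_iff.2 (cell_anc (hB.on' hj) hyb hl)
    · exact on_iff.2 (T.anc_trans (cell_anc (hB.on' hj) hxb hl) (on_iff.1 hon))
  refine ⟨fun j => ?_, fun j k hjk hl => ?_⟩
  · show B (cell (y j).1) = B (cell (z t j).1)
    by_cases hj : j = i
    · subst hj; rw [zi, hBz, h]
    · rw [zj j hj]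
  · change B (cell (y j).1) = B (cell (y k).1) at hjk
    change ht (y j).1 < ht (y k).1 at hl
    show ht (z t j).1 < ht (z t k).1
    by_cases hj : j = i
    · subst hj
      have hk : k ≠ j := by rintro rfl; exact lt_irrefl _ hl
      rw [zi, zj k hk, hht]
      by_contra hn
      rcases Set.mem_uIcc.1 (hs t) with hb1 | hb1
      · refine hno k hk (hlow k (by rw [← hjk, h]) (Or.inr (by linarith))) ?_
        exact Set.mem_uIcc.2 (Or.inl ⟨by linarith, by linarith⟩)
      · linarith
    · rw [zj j hj]
      by_cases hk : k = i
      · subst hk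
        rw [zi, hht]
        by_contra hn
        refine hno j hj (hlow j (by rw [hjk, h]) (Or.inl hl.le)) ?_
        rcases Set.mem_uIcc.1 (hs t) with hb1 | hb1
        · linarith
        · exact Set.mem_uIcc.2 (Or.inr ⟨by linarith, by linarith⟩)
      · rw [zj k hk]; exact hl

lemma move_val {x : Cf T n} (y : Nb x) (i : Fin n) {B : N → N} (hB : T.Chain B)
    (h : B (cell (y i).1) = B (cell (x.1 i))) :
    ψ.ev (nbm x) y (mv x y i) = W ψ B (inc x y) (inc x (mv x y i)) := by
  obtain ⟨p, hp⟩ := move_path y i hB h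
  rw [← ψ.ev_eq (nbm x) p]
  exact (W_eq ψ hB (x := inc x y) (y := inc x (mv x y i)) 1 (p.map (inc x).continuous) hp).symm

lemma st_mv {x : Cf T n} (y : Nb x) (i : Fin n) :
    ∃ m, st (inc x y) = cell (y i).1 ::ₘ m ∧ st (inc x (mv x y i)) = cell (x.1 i) ::ₘ m := by
  classical
  have key : ∀ z : Nb x, st (inc x z) = cell (z i).1 ::ₘ
      (Finset.univ.erase i).val.map fun j => cell (z j).1 := by
    intro z
    have : (Finset.univ : Finset (Fin n)).val = i ::ₘ (Finset.univ.erase i).val := by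
      rw [Finset.erase_val, Multiset.cons_erase (Finset.mem_univ_val i)]
    rw [st, this, Multiset.map_cons]
    rfl
  refine ⟨_, key y, ?_⟩
  rw [key]
  congr 1
  · simp [mv, ctr]
  · apply Multiset.map_congr rfl
    intro j hj
    have : j ≠ i := by
      intro h; subst h; rw [Finset.mem_val] at hj; exact Finset.notMem_erase _ _ hj
    simp [mv, this]

end

end RTree

end GraphBraid


set_option linter.unusedSectionVars false

open unitInterval Topology

namespace GraphBraid

namespace RTree

variable {N : Type} {T : RTree N} {n : ℕ}

/-! ### The elementary coarsenings -/

variable (T) in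
open Classical in
/-- Merging an edge with its parent. -/
noncomputable def Bc (c v : N) : N := if v = T.par c then c else v

lemma Bc_par (c : N) : T.Bc c (T.par c) = c := if_pos rfl

lemma Bc_ne {c v : N} (h : v ≠ T.par c) : T.Bc c v = v := if_neg h

lemma Bc_self {c : N} : T.Bc c c = c := by
  unfold Bc; split_ifs <;> rfl

lemma anc_between {c u : N} (_ : c ≠ T.root) (h : T.Anc (T.par c) u) (h' : T.Anc u c) :
    u = T.par c ∨ u = c := by
  rcases T.anc_cases h' with h1 | h1
  · exact Or.inr h1
  · exact Or.inl (T.anc_antisymm h1.2 h)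

lemma chain_id : T.Chain (id : N → N) :=
  ⟨fun v => T.anc_refl v, fun _ _ h h' => T.anc_antisymm h' h⟩

lemma chain_Bc {c : N} (hc : c ≠ T.root) : T.Chain (T.Bc c) := by
  refine ⟨fun v => ?_, fun v u h h' => ?_⟩
  · by_cases hv : v = T.par c
    · rw [hv, Bc_par]; exact T.anc_par c
    · rw [Bc_ne hv]; exact T.anc_refl v
  · by_cases hv : v = T.par c
    · subst hv
      rw [Bc_par] at h' ⊢
      rcases anc_between hc h h' with rfl | rfl
      · exact Bc_par c
      · exact Bc_self
    · rw [Bc_ne hv] at h'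
      rw [T.anc_antisymm h' h]

lemma chain_BB {c c' : N} (hc : c ≠ T.root) (hc' : c' ≠ T.root) (hp : T.par c ≠ T.par c')
    (hcc : c ≠ T.par c') : T.Chain (fun v => T.Bc c (T.Bc c' v)) := by
  refine ⟨fun v => T.anc_trans ((chain_Bc hc').up v) ((chain_Bc hc).up _), fun v u h h' => ?_⟩
  have e1 : T.Bc c (T.Bc c' c) = c := by rw [Bc_ne hcc, Bc_self]
  by_cases hv : v = T.par c'
  · subst hv
    rw [Bc_par] at h' ⊢
    by_cases h1 : c' = T.par c
    · rw [h1, Bc_par] at h' ⊢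
      by_cases huc : u = c
      · rw [huc, ← h1, e1]
      · have h2 : T.Anc u c' := by
          rcases T.anc_cases h' with h2 | h2
          · exact absurd h2 huc
          · rw [h1]; exact h2.2
        rcases anc_between hc' h h2 with rfl | rfl
        · rw [← h1, Bc_par, h1, Bc_par]
        · rw [← h1, Bc_self, h1, Bc_par]
    · rw [Bc_ne h1] at h' ⊢
      rcases anc_between hc' h h' with rfl | rfl
      · rw [Bc_par, Bc_ne h1]
      · rw [Bc_self, Bc_ne h1]
  · rw [Bc_ne hv] at h' ⊢
    by_cases hvc : v = T.par c
    · subst hvc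
      rw [Bc_par] at h' ⊢
      rcases anc_between hc h h' with rfl | rfl
      · rw [Bc_ne hp, Bc_par]
      · exact e1
    · rw [Bc_ne hvc] at h' ⊢
      rw [T.anc_antisymm h' h, Bc_ne hv, Bc_ne hvc]

lemma BB_coarse {c c' : N} (hp : T.par c ≠ T.par c') (hcc : c ≠ T.par c') (v : N) :
    T.Bc c (T.Bc c' (T.Bc c v)) = T.Bc c (T.Bc c' v) := by
  by_cases hv : v = T.par c
  · subst hv; rw [Bc_par, Bc_ne hcc, Bc_self, Bc_ne hp, Bc_par]
  · rw [Bc_ne hv]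

lemma BB_coarse' {c c' : N} (v : N) :
    T.Bc c (T.Bc c' (T.Bc c' v)) = T.Bc c (T.Bc c' v) := by
  by_cases hv : v = T.par c'
  · subst hv; rw [Bc_par, Bc_self]
  · rw [Bc_ne hv, Bc_ne hv]

lemma map_Bc (c : N) (m : Multiset N) : (c ::ₘ m).map (T.Bc c) = (T.par c ::ₘ m).map (T.Bc c) := by
  simp only [Multiset.map_cons, Bc_self, Bc_par]

/-! ### Standard configurations -/

lemma conf_list (l : List N) : ∃ x : Cf T l.length, (∀ i, cell (x.1 i) = l.get i) ∧
    ∀ i, ht (x.1 i) = T.depth (l.get i) + ((l.length : ℝ) - i) / l.length := by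
  have h0 : ∀ i : Fin l.length, (i : ℝ) < l.length := fun i => by exact_mod_cast i.2
  have hl : ∀ _ : Fin l.length, (0 : ℝ) < l.length := fun i => by
    have := h0 i
    exact lt_of_le_of_lt (Nat.cast_nonneg _) this
  have hpos : ∀ i : Fin l.length, 0 < ((l.length : ℝ) - i) / l.length := fun i =>
    div_pos (by linarith [h0 i]) (hl i)
  have hle : ∀ i : Fin l.length, ((l.length : ℝ) - i) / l.length ≤ 1 := fun i => by
    rw [div_le_one (hl i)]
    have : (0 : ℝ) ≤ (i : ℕ) := Nat.cast_nonneg _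
    linarith
  let x : Fin l.length → T.Y := fun i =>
    T.pt (l.get i) (T.depth (l.get i) + ((l.length : ℝ) - i) / l.length)
  have hcell : ∀ i, cell (x i) = l.get i := fun i =>
    cell_pt (T.anc_refl _) (by linarith [hpos i]) (by linarith [hle i])
  have hht : ∀ i, ht (x i) = T.depth (l.get i) + ((l.length : ℝ) - i) / l.length := fun i =>
    T.ht_pt (by have := hpos i; positivity) (by linarith [hle i])
  refine ⟨⟨x, fun i j h => ?_⟩, hcell, hht⟩
  have h1 : l.get i = l.get j := by rw [← hcell, h, hcell]
  have h2 : ht (x i) = ht (x j) := by rw [h]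
  rw [hht, hht, h1] at h2
  have h3 : ((l.length : ℝ) - i) / l.length = ((l.length : ℝ) - j) / l.length := by linarith
  have h5 : (l.length : ℝ) - i = l.length - j := by
    rwa [div_left_inj' (hl i).ne'] at h3
  apply Fin.ext
  have : (i : ℝ) = j := by linarith
  exact_mod_cast this

lemma st_list {l : List N} {x : Cf T l.length} (h : ∀ i, cell (x.1 i) = l.get i) :
    st x = (l : Multiset N) := by
  simp only [st, h, Fin.univ_val_map]
  exact congrArg _ (List.ofFn_get l)

lemma exists_conf (M : Multiset N) (hM : M.card = n) : ∃ x : Cf T n, st x = M := by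
  obtain ⟨l, rfl⟩ := Quot.exists_rep M
  change l.length = n at hM
  subst hM
  obtain ⟨x, h1, -⟩ := conf_list (T := T) l
  exact ⟨x, st_list h1⟩

lemma exists_top (w : N) (m : Multiset N) (hm : m.card + 1 = n) :
    ∃ x : Cf T n, st x = w ::ₘ m ∧ ∃ i, cell (x.1 i) = w ∧ ht (x.1 i) = T.depth w + 1 := by
  obtain ⟨l, rfl⟩ := Quot.exists_rep m
  change l.length + 1 = n at hm
  subst hm
  obtain ⟨x, h1, h2⟩ := conf_list (T := T) (w :: l)
  refine ⟨x, st_list h1, ⟨0, by simp⟩, h1 _, ?_⟩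
  have := h2 ⟨0, by simp⟩
  rw [this]
  have h3 : (((w :: l).length : ℕ) : ℝ) ≠ 0 := by simp; positivity
  simp only [Nat.cast_zero, sub_zero, div_self h3]
  rfl

instance : Nonempty (Cf T n) := ⟨(exists_conf (Multiset.replicate n T.root) (by simp)).choose⟩

variable (T n) in
open Classical in
/-- A configuration with given state. -/
noncomputable def P (M : Multiset N) : Cf T n :=
  if h : ∃ x : Cf T n, st x = M then h.choose else Classical.arbitrary _

lemma st_P {M : Multiset N} (hM : M.card = n) : st (P T n M) = M := by
  have h : ∃ x : Cf T n, st x = M := exists_conf M hM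
  rw [P, dif_pos h]; exact h.choose_spec

section

variable [LinearOrder N] {A A' : Type} [AddCommGroup A] [AddCommGroup A'] (ψ : PF (UX T n) A)

open Classical in
/-- The cellular cocycle of a path functional. -/
noncomputable def fc (c : N) (m : Multiset N) : A :=
  if c ≠ T.root ∧ m.card + 1 = n then W ψ (T.Bc c) (P T n (c ::ₘ m)) (P T n (T.par c ::ₘ m)) else 0

lemma st_fc {c : N} {m : Multiset N} (hm : m.card + 1 = n) :
    (st (P T n (c ::ₘ m))).map (T.Bc c) = (st (P T n (T.par c ::ₘ m))).map (T.Bc c) := by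
  rw [st_P (by simpa using hm), st_P (by simpa using hm), map_Bc]

lemma fc_eq {c : N} {m : Multiset N} (hc : c ≠ T.root) (hm : m.card + 1 = n) :
    fc ψ c m = W ψ (T.Bc c) (P T n (c ::ₘ m)) (P T n (T.par c ::ₘ m)) := if_pos ⟨hc, hm⟩

lemma fc_map (θ : A →+ A') (c : N) (m : Multiset N) : fc (ψ.map θ) c m = θ (fc ψ c m) := by
  unfold fc
  split_ifs with h
  · exact W_map ψ (chain_Bc h.1) θ (st_fc h.2)
  · exact (map_zero θ).symm

lemma fc_sub (ψ' : PF (UX T n) A) (c : N) (m : Multiset N) :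
    fc (ψ.sub ψ') c m = fc ψ c m - fc ψ' c m := by
  unfold fc
  split_ifs with h
  · exact W_sub ψ (chain_Bc h.1) ψ' (st_fc h.2)
  · simp

lemma fc_squares : T.Squares n (fc ψ) := by
  have key : ∀ c c' m, c ≠ T.root → c' ≠ T.root → T.par c ≠ T.par c' → c ≠ T.par c' →
    m.card + 2 = n →
    fc ψ c (c' ::ₘ m) + fc ψ c' (T.par c ::ₘ m) = fc ψ c' (c ::ₘ m) + fc ψ c (T.par c' ::ₘ m) := by
    intro c c' m hc hc' hp hcc hm
    have hB := chain_BB hc hc' hp hcc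
    have h1 : ∀ x y : N, (x ::ₘ y ::ₘ m).card = n := fun x y => by simpa using hm
    have hm1 : ∀ y : N, (y ::ₘ m).card + 1 = n := fun y => by simpa using hm
    rw [fc_eq ψ hc (hm1 _), fc_eq ψ hc (hm1 _), fc_eq ψ hc' (hm1 _), fc_eq ψ hc' (hm1 _),
      ← W_coarse ψ (chain_Bc hc) hB (BB_coarse hp hcc) (st_fc (hm1 _)),
      ← W_coarse ψ (chain_Bc hc) hB (BB_coarse hp hcc) (st_fc (hm1 _)),
      ← W_coarse ψ (chain_Bc hc') hB BB_coarse' (st_fc (hm1 _)),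
      ← W_coarse ψ (chain_Bc hc') hB BB_coarse' (st_fc (hm1 _)),
      Multiset.cons_swap c' (T.par c) m, Multiset.cons_swap c' c m,
      Multiset.cons_swap c (T.par c') m, Multiset.cons_swap (T.par c') (T.par c) m]
    have g1 : T.Bc c (T.Bc c' c) = T.Bc c (T.Bc c' (T.par c)) := by
      have := BB_coarse hp hcc (T.par c); rwa [Bc_par] at this
    have g2 : T.Bc c (T.Bc c' c') = T.Bc c (T.Bc c' (T.par c')) := by rw [Bc_self, Bc_par]
    rw [W_add ψ hB, W_add ψ hB]
    all_goals
      rw [st_P (h1 _ _), st_P (h1 _ _)]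
      simp only [Multiset.map_cons, g1, g2]
    all_goals exact Multiset.cons_swap _ _ _
  intro c c' m hc hc' hp hm
  by_cases hcc : c = T.par c'
  · have hcc' : c' ≠ T.par c := by
      intro h
      have := T.depth_par c hc
      have := T.depth_par c' hc'
      rw [← hcc] at this; rw [← h] at *; omega
    exact (key c' c m hc' hc hp.symm hcc' hm).symm
  · exact key c c' m hc hc' hp hcc hm

lemma fc_pot (g : UX T n → A) (hg : ∀ (a b : UX T n) (p : Path a b), ψ.val p = g b - g a)
    {c : N} {m : Multiset N} (hc : c ≠ T.root) (hm : m.card + 1 = n) :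
    fc ψ c m = g (qm T n (P T n (T.par c ::ₘ m))) - g (qm T n (P T n (c ::ₘ m))) := by
  rw [fc_eq ψ hc hm, W_pot ψ (chain_Bc hc) g hg (st_fc hm)]

/-- If the cellular cocycle is a coboundary then the functional is a coboundary. -/
lemma generation (g : Multiset N → A)
    (hg : ∀ c m, c ≠ T.root → m.card + 1 = n → fc ψ c m = g (T.par c ::ₘ m) - g (c ::ₘ m)) :
    ∃ G : UX T n → A, ∀ (a b : UX T n) (p : Path a b), ψ.val p = G b - G a := by
  let G₀ : Cf T n → A := fun x => g (st x) - W ψ id x (P T n (st x))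
  have hP : ∀ x : Cf T n, st (P T n (st x)) = st x := fun x => st_P (st_card x)
  have hid : ∀ {x y : Cf T n}, st x = st y → (st x).map id = (st y).map id := fun h => by rw [h]
  have hA : ∀ x y : Cf T n, st x = st y → W ψ id x y = G₀ y - G₀ x := by
    intro x y h
    have h1 := W_add ψ chain_id (hid h) (hid (hP y).symm)
    simp only [G₀, h]
    rw [← h1]; abel
  have hGP : ∀ M : Multiset N, M.card = n → G₀ (P T n M) = g M := by
    intro M hM
    simp only [G₀, st_P hM, W_self ψ chain_id, sub_zero]
  have hc0 : ∀ (B : N → N), T.Chain B → ∀ x y : Cf T n, st x = st y → W ψ B x y = G₀ y - G₀ x := by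
    intro B hB x y h
    rw [W_coarse ψ chain_id hB (fun _ => rfl) (hid h), hA x y h]
  have hC : ∀ (c : N) (m : Multiset N) (x y : Cf T n), c ≠ T.root → st x = c ::ₘ m →
      st y = T.par c ::ₘ m → W ψ (T.Bc c) x y = G₀ y - G₀ x := by
    intro c m x y hc hx hy
    have hB := chain_Bc hc
    have hm : m.card + 1 = n := by
      have := st_card x; rw [hx] at this; simpa using this
    have e1 : st x = st (P T n (c ::ₘ m)) := by rw [st_P (by simpa using hm), hx]
    have e2 : st (P T n (T.par c ::ₘ m)) = st y := by rw [st_P (by simpa using hm), hy]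
    have h1 := hc0 _ hB _ _ e1
    have h2 := hc0 _ hB _ _ e2
    have h3 := hg c m hc hm
    rw [fc_eq ψ hc hm] at h3
    rw [← W_add ψ hB (y := P T n (T.par c ::ₘ m)) (by rw [e1, st_fc hm]) (by rw [e2]),
      ← W_add ψ hB (y := P T n (c ::ₘ m)) (by rw [e1]) (st_fc hm), h1, h2, h3,
      hGP _ (by simpa using hm), hGP _ (by simpa using hm)]
    abel
  have hperm : ∀ x (π : Equiv.Perm (Fin n)), G₀ (perm x π) = G₀ x := by
    intro x π
    have h1 := hA (perm x π) x (st_perm x π)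
    rw [W_perm ψ chain_id] at h1
    exact (sub_eq_zero.1 h1.symm).symm
  let G : UX T n → A := Quot.lift G₀ (by
    rintro x y ⟨π, h⟩
    have : perm x π = y := Subtype.ext h
    rw [← this, hperm])
  have hmv : ∀ (x : Cf T n) (y : Nb x) i,
      ψ.ev (nbm x) y (mv x y i) = G₀ (inc x (mv x y i)) - G₀ (inc x y) := by
    intro x y i
    obtain ⟨m, h1, h2⟩ := st_mv y i
    rcases star_cell ((rad_good x).1 i) (y i).2 with h | ⟨hr, hp, -⟩
    · rw [move_val ψ y i chain_id (congrArg id h)]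
      exact hA _ _ (by rw [h1, h2, h])
    · rw [move_val ψ y i (chain_Bc hr) (by rw [← hp, Bc_self, Bc_par])]
      exact hC _ m _ _ hr h1 (by rw [h2, hp])
  have hctr : ∀ (x : Cf T n) (y : Nb x), ψ.ev (nbm x) y (ctr x) = G₀ x - G₀ (inc x y) := by
    classical
    intro x y
    have : ∀ s : Finset (Fin n), ψ.ev (nbm x) y (s.piecewise (ctr x) y) =
        G₀ (inc x (s.piecewise (ctr x) y)) - G₀ (inc x y) := by
      intro s
      induction s using Finset.induction_on with
      | empty => rw [Finset.piecewise_empty, ψ.ev_self, sub_self]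
      | insert i s hi ih =>
        have e : (insert i s).piecewise (ctr x) y = mv x (s.piecewise (ctr x) y) i := by
          rw [Finset.piecewise_insert, mv]
        rw [e, ← ψ.ev_add _ _ (s.piecewise (ctr x) y), ih, hmv]
        abel
    have := this Finset.univ
    rwa [Finset.piecewise_univ] at this
  have hev : ∀ (x : Cf T n) (y z : Nb x), ψ.ev (nbm x) y z = G₀ (inc x z) - G₀ (inc x y) := by
    intro x y z
    have h1 := hctr x y
    have h2 := hctr x z
    have h3 := ψ.ev_add (nbm x) y z (ctr x)
    rw [h1, h2] at h3
    rw [eq_sub_of_add_eq h3]; abel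
  refine ⟨G, fun a b p => ?_⟩
  have := ψ.local_global (ContinuousMap.id _) G ?_ a b p
  · exact this
  · intro s
    obtain ⟨x, rfl⟩ := Quot.exists_rep s
    refine ⟨Set.range (nbm x), (nbm_emb x).isOpen_range.mem_nhds ⟨ctr x, rfl⟩, ?_⟩
    intro a b p hp
    obtain ⟨s, hs⟩ := hp ⟨0, p.source⟩
    obtain ⟨s', hs'⟩ := hp ⟨1, p.target⟩
    have h1 := loc_val ψ x p hp s s' hs hs'
    rw [hev] at h1
    subst hs; subst hs'
    exact h1

end

end RTree

end GraphBraid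


set_option linter.unusedSectionVars false

open unitInterval Topology

namespace GraphBraid

namespace RTree

variable {N : Type} {T : RTree N} {n : ℕ}

lemma pot_sub [LinearOrder N] {A : Type} [AddCommGroup A] (f f' : N → Multiset N → A)
    (M : Multiset N) : T.pot (fun c m => f c m - f' c m) M = T.pot f M - T.pot f' M := by
  induction M using T.pot_ind with
  | h0 M h => rw [pot_not _ _ h, pot_not _ _ h, pot_not _ _ h, sub_zero]
  | h c m hc ih => rw [pot_min _ _ hc, pot_min _ _ hc, pot_min _ _ hc, ih]; abel

lemma not_isMin [LinearOrder N] {M : Multiset N} (h : ¬ ∃ c, T.IsMinIn c M) :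
    M = Multiset.replicate M.card T.root := by
  rw [Multiset.eq_replicate]
  refine ⟨rfl, fun b hb => ?_⟩
  by_contra hn
  exact h (T.exists_isMinIn ⟨b, hb, hn⟩)

lemma pot_cob [LinearOrder N] {A : Type} [AddCommGroup A] (f : N → Multiset N → A)
    (g : Multiset N → A)
    (h : ∀ c m, c ≠ T.root → m.card + 1 = n → f c m = g (T.par c ::ₘ m) - g (c ::ₘ m))
    (M : Multiset N) (hM : M.card = n) :
    T.pot f M = g M - g (Multiset.replicate n T.root) := by
  induction M using T.pot_ind with
  | h0 M h' =>
    have := not_isMin h'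
    rw [hM] at this
    rw [pot_not _ _ h', this, sub_self]
  | h c m hc ih =>
    have hm : m.card + 1 = n := by simpa using hM
    rw [pot_min _ _ hc, ih (by simpa using hM), h c m hc.2.1 hm]; abel

lemma nrm_cob [LinearOrder N] {A : Type} [AddCommGroup A] (f : N → Multiset N → A)
    (g : Multiset N → A)
    (h : ∀ c m, c ≠ T.root → m.card + 1 = n → f c m = g (T.par c ::ₘ m) - g (c ::ₘ m))
    (c : N) (m : Multiset N) (hc : c ≠ T.root) (hm : m.card + 1 = n) : T.nrm f c m = 0 := by
  rw [nrm, pot_cob f g h _ (by simpa using hm), pot_cob f g h _ (by simpa using hm), h c m hc hm]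
  abel

/-- The model configuration space is path connected. -/
lemma ux_connected [LinearOrder N] : PathConnectedSpace (UX T n) := by
  have hW : ∀ (B : N → N), T.Chain B → ∀ x y : Cf T n, (st x).map B = (st y).map B →
      Joined (qm T n x) (qm T n y) := by
    intro B hB x y h
    obtain ⟨π, p, -⟩ := exists_W hB h
    exact ⟨(p.map (qm T n).continuous).cast rfl (qm_perm y π).symm⟩
  have hP : ∀ M : Multiset N, M.card = n →
      Joined (qm T n (P T n M)) (qm T n (P T n (Multiset.replicate n T.root))) := by
    intro M hM
    induction M using T.pot_ind with
    | h0 M h =>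
      have := not_isMin h
      rw [hM] at this
      rw [this]
    | h c m hc ih =>
      have hm : m.card + 1 = n := by simpa using hM
      exact (hW _ (chain_Bc hc.2.1) _ _ (st_fc hm)).trans (ih (by simpa using hM))
  have hx : ∀ x : Cf T n,
      Joined (qm T n x) (qm T n (P T n (Multiset.replicate n T.root))) := fun x =>
    (hW id chain_id _ _ (by rw [st_P (st_card x)])).trans (hP (st x) (st_card x))
  refine ⟨⟨qm T n (Classical.arbitrary _)⟩, fun a b => ?_⟩
  obtain ⟨x, rfl⟩ := Quot.exists_rep a
  obtain ⟨y, rfl⟩ := Quot.exists_rep b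
  exact (hx x).trans (hx y).symm

section

variable [LinearOrder N]

variable (T n) in
/-- Critical cells. -/
def Crit (c : N) (a : Multiset N) : Prop :=
  c ≠ T.root ∧ a.card + 1 = n ∧ (∀ x ∈ a, x = T.par c ∨ (x ≠ T.root ∧ T.par x = T.par c)) ∧
    ∃ s ∈ a, s ≠ T.root ∧ T.par s = T.par c ∧ s < c

variable (T n) in
/-- The type of critical cells. -/
def K : Type := {k : N × Multiset N // T.Crit n k.1 k.2}

open Classical in
variable (T n) in
/-- The universal cochain. -/
noncomputable def phi (c : N) (a : Multiset N) : FreeAbelianGroup (K T n) :=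
  if h : T.Crit n c a then FreeAbelianGroup.of ⟨(c, a), h⟩ else 0

open Classical in
variable (T n) in
/-- Local potentials. -/
noncomputable def lp (w h : N) (a : Multiset N) : FreeAbelianGroup (K T n) :=
  if h ≠ T.root ∧ T.par h = w then - phi T n h a else 0

variable (T n) in
/-- Local increments. -/
noncomputable def inr (w : N) (s s' : Multiset N) : FreeAbelianGroup (K T n) :=
  ((s' - s).map (fun h => lp T n w h (s ∩ s'))).sum -
    ((s - s').map (fun h => lp T n w h (s ∩ s'))).sum

lemma inr_self (w : N) (s : Multiset N) : inr T n w s s = 0 := sub_self _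

lemma inr_cons (w h h' : N) (a : Multiset N) :
    inr T n w (h ::ₘ a) (h' ::ₘ a) = lp T n w h' a - lp T n w h a := by
  by_cases e : h = h'
  · rw [e, inr_self, sub_self]
  · have e1 : ∀ h h' : N, h ≠ h' → (h' ::ₘ a) - (h ::ₘ a) = {h'} := by
      intro h h' e
      ext x
      simp only [Multiset.count_sub, Multiset.count_cons, Multiset.count_singleton]
      by_cases h1 : x = h' <;> by_cases h2 : x = h
      · exact absurd (h2.symm.trans h1) e
      all_goals simp only [h1, h2, if_true, if_false]
      all_goals first | omega | (split_ifs <;> simp_all)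
    have e3 : (h ::ₘ a) ∩ (h' ::ₘ a) = a := by
      ext x
      simp only [Multiset.count_inter, Multiset.count_cons]
      by_cases h1 : x = h' <;> by_cases h2 : x = h
      · exact absurd (h2.symm.trans h1) e
      all_goals simp_all
    rw [inr, e1 h h' e, e1 h' h (Ne.symm e), e3]
    simp

variable [Fintype N]

variable (T n) in
/-- Total increments. -/
noncomputable def kap (M M' : Multiset N) : FreeAbelianGroup (K T n) :=
  ∑ w, inr T n w (M.map (T.br w)) (M'.map (T.br w))

lemma kap_self (M : Multiset N) : kap T n M M = 0 :=
  Finset.sum_eq_zero fun w _ => inr_self w _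

lemma kap_move {c : N} (hc : c ≠ T.root) (m : Multiset N) :
    kap T n (c ::ₘ m) (T.par c ::ₘ m) = phi T n c (m.map (T.br (T.par c))) := by
  rw [kap, Finset.sum_eq_single (T.par c)]
  · simp only [Multiset.map_cons]
    rw [inr_cons, T.br_self, T.br_child hc, lp, lp, if_neg, if_pos ⟨hc, rfl⟩]
    · simp
    · rintro ⟨h1, h2⟩; exact T.par_ne h1 h2
  · intro w _ hw
    simp only [Multiset.map_cons]
    rw [T.br_par hc (Ne.symm hw), inr_self]
  · simp

lemma loc_br (x : Cf T n) (w : N) :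
    (∃ (a : Multiset N) (h : Nb x → N), ∀ s, (st (inc x s)).map (T.br w) = h s ::ₘ a) ∨
      ∃ a, ∀ s, (st (inc x s)).map (T.br w) = a := by
  have key : ∀ (s : Nb x) j, ¬ (cell (x.1 j) = w ∧ ht (x.1 j) = T.depth w + 1) →
      T.br w (cell (s j).1) = T.br w (cell (x.1 j)) := by
    intro s j hj
    rcases star_cell ((rad_good x).1 j) (s j).2 with h | ⟨h1, h2, h3⟩
    · rw [h]
    · have : T.par (cell (s j).1) ≠ w := by
        intro h
        rw [h] at h2
        exact hj ⟨h2.symm, by rw [h3, h2]⟩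
      rw [← h2, T.br_par h1 this]
  by_cases hex : ∃ i, cell (x.1 i) = w ∧ ht (x.1 i) = T.depth w + 1
  · left
    obtain ⟨i, hi1, hi2⟩ := hex
    refine ⟨(Finset.univ.erase i).val.map fun j => T.br w (cell (x.1 j)),
      fun s => T.br w (cell (s i).1), fun s => ?_⟩
    have : (Finset.univ : Finset (Fin n)).val = i ::ₘ (Finset.univ.erase i).val := by
      rw [Finset.erase_val, Multiset.cons_erase (Finset.mem_univ_val i)]
    rw [st, Multiset.map_map, this, Multiset.map_cons]
    congr 1
    apply Multiset.map_congr rfl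
    intro j hj
    rw [Finset.mem_val] at hj
    refine key s j ?_
    rintro ⟨h1, h2⟩
    have e : x.1 j = x.1 i := (cell_spec (x.1 j)).1.eq (b := cell (x.1 j))
      (on_iff.2 (by rw [h1, hi1]; exact T.anc_refl w)) (by rw [h2, hi2])
    exact (Finset.mem_erase.1 hj).1 (x.2 e)
  · right
    refine ⟨Finset.univ.val.map fun j => T.br w (cell (x.1 j)), fun s => ?_⟩
    rw [st, Multiset.map_map]
    apply Multiset.map_congr rfl
    intro j _
    exact key s j fun h => hex ⟨j, h⟩

/-- State of an unordered configuration. -/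
noncomputable def stq : UX T n → Multiset N := Quot.lift st (by
  rintro x y ⟨π, h⟩
  have : perm x π = y := Subtype.ext h
  rw [← this, st_perm])

lemma locAdd : LocAdd (fun p p' : UX T n => kap T n (stq p) (stq p'))
    (fun p => Set.range (nbm p.out)) where
  isOpen p := (nbm_emb _).isOpen_range
  mem p := ⟨ctr _, Quot.out_eq p⟩
  add := by
    rintro p _ ⟨y, rfl⟩ _ ⟨z, rfl⟩ _ ⟨u, rfl⟩
    show kap T n (st (inc _ y)) (st (inc _ z)) + kap T n (st (inc _ z)) (st (inc _ u)) =
      kap T n (st (inc _ y)) (st (inc _ u))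
    simp only [kap]
    rw [← Finset.sum_add_distrib]
    refine Finset.sum_congr rfl fun w _ => ?_
    rcases loc_br p.out w with ⟨a, h, hh⟩ | ⟨a, hh⟩
    · rw [hh, hh, hh, inr_cons, inr_cons, inr_cons]; abel
    · rw [hh, hh, hh, inr_self, add_zero]

variable (T n) in
/-- The universal path functional. -/
noncomputable def Phi : PF (UX T n) (FreeAbelianGroup (K T n)) := (locAdd (T := T) (n := n)).int

lemma Phi_id {x y : Cf T n} (h : st x = st y) : W (Phi T n) id x y = 0 := by
  obtain ⟨π, p, hp⟩ := exists_W (B := id) chain_id (x := x) (y := y) (by rw [h])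
  rw [W_eq (Phi T n) chain_id π p hp]
  have hst : ∀ t, st (p t) = st x := fun t =>
    Multiset.map_congr rfl fun i _ => ((hp t).1 i).symm
  let F : C(I, UX T n) := (qm T n).comp ⟨p, p.continuous⟩
  let ip : Path (0 : I) 1 := ⟨ContinuousMap.id I, rfl, rfl⟩
  have h1 := (Phi T n).local_global F (fun _ => 0) ?_ 0 1 ip
  · rw [sub_zero] at h1
    rw [← h1, qv, ← (Phi T n).val_cast (ip.map F.continuous) (x' := qm T n x)
      (y' := qm T n (perm y π)) (congrArg (qm T n) p.source).symm
        (congrArg (qm T n) p.target).symm]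
    congr 1
  · intro t
    refine ⟨F ⁻¹' (Set.range (nbm (F t).out)),
      ((nbm_emb _).isOpen_range.preimage F.continuous).mem_nhds ⟨ctr _, Quot.out_eq (F t)⟩, ?_⟩
    intro a b r hr
    have h2 := locAdd.int_local (F t) (r.map F.continuous) (by
      rintro _ ⟨u, rfl⟩
      exact hr ⟨u, rfl⟩)
    rw [sub_zero]
    refine h2.trans ?_
    show kap T n (st (p a)) (st (p b)) = 0
    rw [hst, hst, kap_self]

lemma Phi_same {B : N → N} (hB : T.Chain B) {x y : Cf T n} (h : st x = st y) :
    W (Phi T n) B x y = 0 := by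
  rw [W_coarse _ chain_id hB (fun _ => rfl) (by rw [h]), Phi_id h]

lemma exists_top' (w : N) (m : Multiset N) (hm : m.card + 1 = n) :
    ∃ x : Cf T n, (qm T n x).out = x ∧ st x = w ::ₘ m ∧
      ∃ i, cell (x.1 i) = w ∧ ht (x.1 i) = T.depth w + 1 := by
  obtain ⟨z, hz, i, hi⟩ := exists_top (T := T) w m hm
  have h : qm T n (qm T n z).out = qm T n z := Quot.out_eq _
  obtain ⟨π, hπ⟩ := qm_eq.1 h.symm
  refine ⟨(qm T n z).out, by rw [h], by rw [← hπ, st_perm, hz], π⁻¹ i, ?_⟩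
  rw [← hπ]
  simpa [perm] using hi

lemma fc_Phi {c : N} (hc : c ≠ T.root) {m : Multiset N} (hm : m.card + 1 = n) :
    fc (Phi T n) c m = phi T n c (m.map (T.br (T.par c))) := by
  classical
  obtain ⟨z, hout, hz, i, hi1, hi2⟩ := exists_top' (T := T) (T.par c) m hm
  have hr := rad_pos z
  have hr1 : rad z ≤ 1 := ((rad_good z).1 i).2.1
  have hd : (T.depth c : ℝ) = T.depth (T.par c) + 1 := by exact_mod_cast T.depth_par c hc
  have hd0 : (0 : ℝ) ≤ T.depth (T.par c) := Nat.cast_nonneg _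
  let y₀ := T.pt c (T.depth c + rad z / 2)
  have hy : ht y₀ = T.depth c + rad z / 2 := T.ht_pt (by linarith) (by linarith)
  have hcell : cell y₀ = c := cell_pt (T.anc_refl c) (by linarith) (by linarith)
  have hmem : y₀ ∈ star (z.1 i) (rad z) := by
    refine ⟨?_, fun _ => ?_⟩
    · rw [hy, hi2, ← hd, add_sub_cancel_left, abs_of_pos (by linarith)]; linarith
    · rw [co_cell_pos (T.pt_on c _), hi1]
      refine ⟨T.anc_par c, ?_⟩
      show _ < ht y₀
      rw [hy]; linarith
  let y : Nb z := Function.update (ctr z) i ⟨y₀, hmem⟩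
  have hyi : (y i).1 = y₀ := by simp [y]
  have hmv : mv z y i = ctr z := by simp [mv, y]
  obtain ⟨m', h1, h2⟩ := st_mv y i
  rw [hmv, inc_ctr, hz, hi1] at h2
  have hmm : m = m' := (Multiset.cons_inj_right _).1 h2
  subst hmm
  rw [hyi, hcell] at h1
  have hB := chain_Bc hc
  have h3 := move_val (Phi T n) y i hB (by rw [hyi, hcell, hi1, Bc_self, Bc_par])
  rw [hmv, inc_ctr] at h3
  have h4 : (Phi T n).ev (nbm z) y (ctr z) = kap T n (st (inc z y)) (st z) := by
    rw [← (Phi T n).ev_eq (nbm z) (PathConnectedSpace.somePath y (ctr z))]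
    refine (locAdd.int_local (qm T n z) _ ?_).trans rfl
    rintro _ ⟨t, rfl⟩
    rw [hout]
    exact ⟨_, rfl⟩
  rw [h1, hz, kap_move hc] at h4
  have s1 : st (P T n (c ::ₘ m)) = st (inc z y) := by rw [st_P (by simpa using hm), h1]
  have s2 : st z = st (P T n (T.par c ::ₘ m)) := by rw [st_P (by simpa using hm), hz]
  rw [fc_eq _ hc hm, ← h4, h3,
    ← W_add (Phi T n) hB (y := z) (by rw [s2, st_fc hm]) (by rw [s2]),
    ← W_add (Phi T n) hB (y := inc z y) (by rw [s1]) (by rw [← s1, s2, st_fc hm]),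
    Phi_same hB s1, Phi_same hB s2, zero_add, add_zero]

lemma nrm_Phi (hT : T.IsDFS) {c : N} {a : Multiset N} (h : T.Crit n c a) :
    T.nrm (fc (Phi T n)) c a = FreeAbelianGroup.of ⟨(c, a), h⟩ := by
  have hz : ∀ M : Multiset N, M.card = n → T.pot (fc (Phi T n)) M = 0 := by
    refine T.pot_zero _ fun c m hm hmin => ?_
    rw [fc_Phi hmin.2.1 hm, phi, dif_neg]
    rintro ⟨h1, h2, h3, s, hs, h4, h5, h6⟩
    obtain ⟨x, hx, rfl⟩ := Multiset.mem_map.1 hs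
    rcases T.br_spec (T.par c) x with ⟨-, -, h7⟩ | ⟨h7, -⟩
    · have h8 := hT.lower c _ x h1 h4 h5 h6 h7
      have hxr : x ≠ T.root := by
        rintro rfl
        exact h4 (T.anc_antisymm h7 (T.root_anc _))
      exact absurd (hmin.2.2 x (Multiset.mem_cons_of_mem hx) hxr) (not_le.2 h8)
    · rw [h7] at h4 h5
      exact T.par_ne h4 h5
  have hm := h.2.1
  rw [nrm, hz _ (by simpa using hm), hz _ (by simpa using hm), fc_Phi h.1 hm]
  have : a.map (T.br (T.par c)) = a := by
    conv_rhs => rw [← Multiset.map_id a]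
    refine Multiset.map_congr rfl fun x hx => ?_
    rcases h.2.2.1 x hx with rfl | ⟨h1, h2⟩
    · exact T.br_self _
    · rw [← h2]; exact T.br_child h1
  rw [this, phi, dif_pos h, sub_zero, sub_zero]

/-- The main theorem for the model. -/
theorem model_iso (hT : T.IsDFS) (x₀ : UX T n) :
    Nonempty (Abelianization (FundamentalGroup (UX T n) x₀) ≃*
      Multiplicative (FreeAbelianGroup (K T n))) := by
  have := ux_connected (T := T) (n := n)
  refine PF.abelianization_iso x₀ (K T n) (fun A _ ψ k => T.nrm (fc ψ) k.1.1 k.1.2) ?_ ?_ ?_ ?_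
    (Phi T n) ?_
  · intro A A' _ _ θ ψ k
    have e : fc (ψ.map θ) = fun c m => θ (fc ψ c m) := by
      funext c m; exact fc_map ψ θ c m
    simp only [nrm, e, map_sub, T.pot_map]
  · intro A _ ψ ψ' k
    have e : fc (ψ.sub ψ') = fun c m => fc ψ c m - fc ψ' c m := by
      funext c m; exact fc_sub ψ ψ' c m
    simp only [nrm, e, pot_sub]
    abel
  · intro A _ ψ h k
    obtain ⟨g, hg⟩ := ψ.exists_pot x₀ h
    exact nrm_cob (fc ψ) (fun M => g (qm T n (P T n M)))
      (fun c m hc hm => fc_pot ψ g hg hc hm) _ _ k.2.1 k.2.2.1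
  · intro A _ ψ h p
    have h1 := T.nrm_eq_zero hT (fc_squares ψ)
      (fun c hc a ha h1 h2 => h ⟨(c, a), hc, ha, h1, h2⟩)
    obtain ⟨G, hG⟩ := generation ψ (T.pot (fc ψ)) fun c m hc hm => sub_eq_zero.1 (h1 c hc m hm)
    rw [hG, sub_self]
  · intro k
    exact nrm_Phi hT k.2

end

end RTree

end GraphBraid


set_option linter.unusedSectionVars false

open unitInterval Topology

namespace GraphBraid

/-! ### Transport along homeomorphisms -/

lemma fg_homeo {X Y : Type} [TopologicalSpace X] [TopologicalSpace Y] (e : X ≃ₜ Y) (x : X) :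
    Nonempty (FundamentalGroup X x ≃* FundamentalGroup Y (e x)) := by
  refine ⟨MulEquiv.ofBijective (FundamentalGroup.map (e : C(X, Y)) x) ⟨?_, ?_⟩⟩
  · have h : Function.LeftInverse (FundamentalGroup.mapOfEq (e.symm : C(Y, X))
        (e.symm_apply_apply x)) (FundamentalGroup.map (e : C(X, Y)) x) := by
      intro p
      rw [FundamentalGroup.mapOfEq_apply]
      induction p using Path.Homotopic.Quotient.ind with
      | _ p =>
        show Path.Homotopic.Quotient.mk (((p.map e.continuous).map e.symm.continuous).cast _ _) = _
        congr 1
        ext t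
        simp
    exact h.injective
  · intro q
    induction q using Path.Homotopic.Quotient.ind with
    | _ q =>
      refine ⟨Path.Homotopic.Quotient.mk ((q.map e.symm.continuous).cast
        (e.symm_apply_apply x).symm (e.symm_apply_apply x).symm), ?_⟩
      show Path.Homotopic.Quotient.mk (Path.map _ e.continuous) = _
      congr 1
      ext t
      simp

lemma uconf_homeo {X Y : Type} [TopologicalSpace X] [TopologicalSpace Y] (e : X ≃ₜ Y) (n : ℕ) :
    Nonempty (UConf n X ≃ₜ UConf n Y) := by
  refine ⟨Homeomorph.Quot.congr (Homeomorph.subtype (Homeomorph.piCongrRight fun _ => e) ?_) ?_⟩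
  · intro f
    exact (e.injective.of_comp_iff f).symm
  · rintro ⟨f, hf⟩ ⟨g, hg⟩
    refine exists_congr fun p => ?_
    constructor
    · intro h
      funext i
      exact congrArg e (congrFun h i)
    · intro h
      funext i
      exact e.injective (congrFun h i)

/-! ### Rooting a tree -/

section root

variable {V : Type} {G : SimpleGraph V} {ρ : V}

/-- The vertex below `v`. -/
noncomputable def up (T : RTree {v : V // v ≠ ρ}) (v : {v : V // v ≠ ρ}) : V :=
  open Classical in if v = T.root then ρ else (T.par v).1

lemma up_root (T : RTree {v : V // v ≠ ρ}) : up T T.root = ρ := if_pos rfl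

lemma up_par {T : RTree {v : V // v ≠ ρ}} {v : {v : V // v ≠ ρ}} (h : v ≠ T.root) :
    up T v = (T.par v).1 := if_neg h

/-- `v` lies directly above `u`. -/
def Ch (T : RTree {v : V // v ≠ ρ}) (u v : V) : Prop := ∃ h : v ≠ ρ, up T ⟨v, h⟩ = u

lemma Ch.asymm {T : RTree {v : V // v ≠ ρ}} {u v : V} (h : Ch T u v) : ¬ Ch T v u := by
  rintro ⟨h2, h3⟩
  obtain ⟨h0, h1⟩ := h
  have a1 : (⟨v, h0⟩ : {v : V // v ≠ ρ}) ≠ T.root := by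
    intro a; rw [a, up_root] at h1; exact h2 h1.symm
  have a2 : (⟨u, h2⟩ : {v : V // v ≠ ρ}) ≠ T.root := by
    intro a; rw [a, up_root] at h3; exact h0 h3.symm
  rw [up_par a1] at h1
  rw [up_par a2] at h3
  have b1 := T.depth_par _ a1
  have b2 := T.depth_par _ a2
  rw [show T.par ⟨v, h0⟩ = ⟨u, h2⟩ from Subtype.ext h1] at b1
  rw [show T.par ⟨u, h2⟩ = ⟨v, h0⟩ from Subtype.ext h3] at b2
  omega

lemma exists_below (hG : G.IsTree) {v : V} (hv : v ≠ ρ) :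
    ∃ u, G.Adj v u ∧ G.dist ρ v = G.dist ρ u + 1 := by
  obtain ⟨p, hp, hl⟩ := hG.connected.exists_path_of_dist v ρ
  cases p with
  | nil => exact absurd rfl hv
  | @cons _ u _ h q =>
    refine ⟨u, h, ?_⟩
    rw [SimpleGraph.Walk.length_cons, G.dist_comm] at hl
    have h1 := G.dist_le q
    rw [G.dist_comm] at h1
    rcases hG.dist_eq_dist_add_one_of_adj ρ h with h2 | h2 <;> omega

lemma below_unique (hG : G.IsTree) {v u u' : V} (h : G.Adj v u) (h' : G.Adj v u')
    (e : G.dist ρ v = G.dist ρ u + 1) (e' : G.dist ρ v = G.dist ρ u' + 1) : u = u' := by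
  obtain ⟨p, hp, hl⟩ := hG.connected.exists_path_of_dist u ρ
  obtain ⟨p', hp', hl'⟩ := hG.connected.exists_path_of_dist u' ρ
  have a1 : (SimpleGraph.Walk.cons h p).IsPath := SimpleGraph.Walk.isPath_of_length_eq_dist _ (by
    rw [SimpleGraph.Walk.length_cons, hl, G.dist_comm, ← e, G.dist_comm])
  have a2 : (SimpleGraph.Walk.cons h' p').IsPath := SimpleGraph.Walk.isPath_of_length_eq_dist _ (by
    rw [SimpleGraph.Walk.length_cons, hl', G.dist_comm, ← e', G.dist_comm])
  have := (hG.existsUnique_path v ρ).unique a1 a2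
  injection this

lemma exists_rtree (hG : G.IsTree) {r : V} (hr : ∀ v, G.Adj ρ v ↔ v = r) :
    ∃ T : RTree {v : V // v ≠ ρ}, ∀ u v, G.Adj u v ↔ Ch T u v ∨ Ch T v u := by
  classical
  have hρr : G.Adj ρ r := (hr r).2 rfl
  have hr0 : r ≠ ρ := hρr.ne'
  have hpos : ∀ v, v ≠ ρ → 0 < G.dist ρ v := fun v hv => hG.connected.pos_dist_of_ne hv.symm
  have hd1 : ∀ v, G.dist ρ v = 1 ↔ v = r := fun v => by rw [SimpleGraph.dist_eq_one_iff_adj, hr]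
  have hb : ∀ v : {v : V // v ≠ ρ}, ∃ u, G.Adj v.1 u ∧ G.dist ρ v.1 = G.dist ρ u + 1 :=
    fun v => exists_below hG v.2
  choose b hb1 hb2 using hb
  have hb3 : ∀ v, v.1 ≠ r → b v ≠ ρ := by
    intro v hv e
    have := hb2 v
    rw [e, SimpleGraph.dist_self] at this
    exact hv ((hd1 _).1 this)
  let T : RTree {v : V // v ≠ ρ} :=
    { root := ⟨r, hr0⟩
      par := fun v => if h : v.1 ≠ r then ⟨b v, hb3 v h⟩ else ⟨r, hr0⟩
      depth := fun v => G.dist ρ v.1 - 1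
      par_root := by simp
      depth_root := by simp [(hd1 r).2 rfl]
      depth_par := by
        intro v hv
        have h : v.1 ≠ r := fun h => hv (Subtype.ext h)
        have h1 := hb2 v
        have h2 := hpos _ (hb3 v h)
        simp only [dif_pos h]
        omega }
  have hup : ∀ v, up T v = b v := by
    intro v
    by_cases h : v = T.root
    · have h' : v.1 = r := congrArg Subtype.val h
      have h2 := hb2 v
      rw [(hd1 _).2 h'] at h2
      rw [h, up_root, ← h]
      by_contra h3
      have := hpos _ (Ne.symm h3)
      omega
    · rw [up_par h]
      have h' : v.1 ≠ r := fun h' => h (Subtype.ext h')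
      show (if h : v.1 ≠ r then (⟨b v, hb3 v h⟩ : {v : V // v ≠ ρ}) else ⟨r, hr0⟩).1 = b v
      rw [dif_pos h']
  refine ⟨T, fun u v => ⟨fun h => ?_, ?_⟩⟩
  · rcases hG.dist_eq_dist_add_one_of_adj ρ h with h1 | h1
    · right
      have hu : u ≠ ρ := by rintro rfl; simp at h1
      exact ⟨hu, (hup _).trans (below_unique hG (hb1 ⟨u, hu⟩) h (hb2 ⟨u, hu⟩) h1)⟩
    · left
      have hv : v ≠ ρ := by rintro rfl; simp at h1
      exact ⟨hv, (hup _).trans (below_unique hG (hb1 ⟨v, hv⟩) h.symm (hb2 ⟨v, hv⟩) h1)⟩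
  · rintro (⟨h, h1⟩ | ⟨h, h1⟩)
    · rw [← h1, hup]; exact (hb1 _).symm
    · rw [← h1, hup]; exact hb1 ⟨u, h⟩

/-! ### The homeomorphism with the model -/

variable {T : RTree {v : V // v ≠ ρ}} (hT : ∀ u v, G.Adj u v ↔ Ch T u v ∨ Ch T v u)

/-- The map from edges to the model. -/
noncomputable def em (hT : ∀ u v, G.Adj u v ↔ Ch T u v ∨ Ch T v u) (e : EdgeIdx G) (t : ℝ) : T.Y :=
  open Classical in
  if h : Ch T e.1.1 e.1.2 then T.pt ⟨e.1.2, h.1⟩ (T.depth ⟨e.1.2, h.1⟩ + t)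
  else T.pt ⟨e.1.1, (((hT _ _).1 e.2).resolve_left h).1⟩
    (T.depth ⟨e.1.1, (((hT _ _).1 e.2).resolve_left h).1⟩ + 1 - t)

/-- Vertices in the model. -/
noncomputable def vp (T : RTree {v : V // v ≠ ρ}) (v : V) : T.Y :=
  open Classical in
  if h : v = ρ then T.pt T.root 0 else T.pt ⟨v, h⟩ (T.depth ⟨v, h⟩ + 1)

lemma pt_below (v : {v : V // v ≠ ρ}) : T.pt v (T.depth v) = vp T (up T v) := by
  by_cases h : v = T.root
  · rw [h, up_root, vp, dif_pos rfl, T.depth_root]; simp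
  · rw [up_par h, vp, dif_neg (T.par v).2]
    have e : (T.depth v : ℝ) = T.depth (T.par v) + 1 := by exact_mod_cast T.depth_par v h
    have e1 : RTree.ht (T.pt v (T.depth v)) = T.depth v := T.ht_pt (by positivity) (by linarith)
    refine RTree.On.eq (b := T.par v) ⟨?_, ?_⟩ (T.pt_on _ _) ?_
    · rw [e1, e]
    · rw [(T.pt_on v _).2, T.ray_anc (T.anc_par v)]
      rw [e1, e]
    · rw [e1, T.ht_pt (by positivity) le_rfl, e]

lemma em_zero (e : EdgeIdx G) : em hT e 0 = vp T e.1.1 := by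
  unfold em
  split_ifs with h
  · rw [add_zero, pt_below, h.2]
  · rw [sub_zero, vp, dif_neg]

lemma em_congr {e e' : EdgeIdx G} (t t' : ℝ) (h1 : e.1.1 = e'.1.2) (h2 : e.1.2 = e'.1.1)
    (h3 : t = 1 - t') : em hT e t = em hT e' t' := by
  obtain ⟨⟨u, v⟩, h⟩ := e
  obtain ⟨⟨u', v'⟩, h'⟩ := e'
  dsimp only at h1 h2
  subst h1 h2 h3
  by_cases hc : Ch T u v
  · have hc' : ¬ Ch T v u := hc.asymm
    unfold em
    rw [dif_pos hc, dif_neg hc']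
    simp only [add_sub_assoc]
  · have hc' : Ch T v u := ((hT _ _).1 h).resolve_left hc
    unfold em
    rw [dif_neg hc, dif_pos hc']
    congr 1
    ring

/-- The comparison map. -/
noncomputable def cm (hT : ∀ u v, G.Adj u v ↔ Ch T u v ∨ Ch T v u) : Realization G → T.Y :=
  Quot.lift (fun x => em hT x.1 x.2) (by
    rintro x y (⟨h1, h2, h3⟩ | ⟨h1, h2, h3⟩)
    · exact em_congr hT _ _ h1 h2 h3
    · simp only [h2, h3, em_zero, h1])

lemma em_continuous (e : EdgeIdx G) : Continuous (em hT e) := by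
  unfold em
  split_ifs
  · exact (T.pt_continuous _).comp (by fun_prop)
  · exact (T.pt_continuous _).comp (by fun_prop)

lemma cm_continuous : Continuous (cm hT) := by
  refine continuous_quot_lift _ ?_
  refine continuous_sigma fun e => ?_
  exact (em_continuous hT e).comp continuous_subtype_val

/-- Canonical points of the realization. -/
noncomputable def cp (hT : ∀ u v, G.Adj u v ↔ Ch T u v ∨ Ch T v u) (v : {v : V // v ≠ ρ}) (t : I) :
    Realization G :=
  Quot.mk _ ⟨⟨(up T v, v.1), (hT _ _).2 (Or.inl ⟨v.2, rfl⟩)⟩, t⟩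

lemma cm_cp (v : {v : V // v ≠ ρ}) (t : I) : cm hT (cp hT v t) = T.pt v (T.depth v + t) :=
  dif_pos (⟨v.2, rfl⟩ : Ch T (up T v) v.1)

lemma exists_cp (x : Realization G) : ∃ v t, x = cp hT v t ∧ (v = T.root ∨ 0 < t) := by
  have key : ∃ v t, x = cp hT v t := by
    induction x using Quot.ind with
    | _ x =>
      obtain ⟨e, t⟩ := x
      by_cases hc : Ch T e.1.1 e.1.2
      · have he : e = ⟨(up T ⟨e.1.2, hc.1⟩, e.1.2), (hT _ _).2 (Or.inl ⟨hc.1, rfl⟩)⟩ :=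
          Subtype.ext (Prod.ext hc.2.symm rfl)
        exact ⟨⟨e.1.2, hc.1⟩, t, congrArg (fun e => Quot.mk (GlueRel G) ⟨e, t⟩) he⟩
      · have hc' := ((hT _ _).1 e.2).resolve_left hc
        exact ⟨⟨e.1.1, hc'.1⟩, unitInterval.symm t,
          Quot.sound (Or.inl ⟨rfl, hc'.2.symm, by simp⟩)⟩
  obtain ⟨v, t, rfl⟩ := key
  by_cases hv : v = T.root
  · exact ⟨v, t, rfl, Or.inl hv⟩
  by_cases ht : 0 < t
  · exact ⟨v, t, rfl, Or.inr ht⟩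
  have ht0 : t = 0 := le_antisymm (not_lt.1 ht) t.2.1
  subst ht0
  refine ⟨T.par v, 1, ?_, Or.inr zero_lt_one⟩
  have hadj : G.Adj (T.par v).1 (up T (T.par v)) := (hT _ _).2 (Or.inr ⟨(T.par v).2, rfl⟩)
  have e1 : cp hT v 0 = Quot.mk (GlueRel G) ⟨⟨((T.par v).1, up T (T.par v)), hadj⟩, 0⟩ :=
    Quot.sound (Or.inr ⟨up_par hv, rfl, rfl⟩)
  rw [e1]
  exact Quot.sound (Or.inl ⟨rfl, rfl, by simp⟩)

lemma cm_injective : Function.Injective (cm hT) := by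
  have key : ∀ v (t : I), (v = T.root ∨ 0 < t) → RTree.IsCell v (T.pt v (T.depth v + t)) ∧
      RTree.ht (T.pt v (T.depth v + t)) = T.depth v + t := by
    intro v t h
    have e := T.ht_pt (b := v) (s := T.depth v + t) (by have := t.2.1; positivity)
      (by linarith [t.2.2])
    refine ⟨⟨T.pt_on _ _, h.imp id fun h => ?_⟩, e⟩
    rw [e]
    have : (0 : ℝ) < t := h
    linarith
  intro x y e
  obtain ⟨v, t, rfl, h⟩ := exists_cp hT x
  obtain ⟨w, s, rfl, h'⟩ := exists_cp hT y
  rw [cm_cp, cm_cp] at e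
  have h1 := key v t h
  have h2 := key w s h'
  rw [e] at h1
  obtain rfl := h1.1.unique h2.1
  have : (t : ℝ) = s := by linarith [h1.2.symm.trans h2.2]
  rw [Subtype.ext this]

lemma cm_surjective : Function.Surjective (cm hT) := by
  intro y
  have h1 := RTree.ht_le y
  have h2 := RTree.depth_le_ht y
  refine ⟨cp hT (RTree.cell y) ⟨RTree.ht y - T.depth (RTree.cell y), by linarith, by linarith⟩, ?_⟩
  rw [cm_cp]
  simp only [add_sub_cancel]
  exact (RTree.cell_spec y).1.pt_eq

lemma exists_homeo [Finite V] (hT : ∀ u v, G.Adj u v ↔ Ch T u v ∨ Ch T v u) :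
    Nonempty (Realization G ≃ₜ T.Y) := by
  have : Finite (EdgeIdx G) := inferInstanceAs (Finite {p : V × V // G.Adj p.1 p.2})
  have : CompactSpace (Realization G) := Quot.compactSpace
  exact ⟨Continuous.homeoOfEquivCompactToT2
    (f := Equiv.ofBijective (cm hT) ⟨cm_injective hT, cm_surjective hT⟩) (cm_continuous hT)⟩

end root

end GraphBraid


set_option linter.unusedSectionVars false

open unitInterval Topology

namespace GraphBraid

lemma card_fsym {α : Type} [DecidableEq α] (S : Finset α) (k : ℕ) :
    (S.sym k).card = Nat.multichoose S.card k := by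
  have h : S = (Finset.univ : Finset S).map (Function.Embedding.subtype _) := by
    ext x; simp
  conv_lhs => rw [h]
  rw [Finset.sym_map, Finset.card_map, Finset.sym_univ, Finset.card_univ,
    Sym.card_sym_eq_multichoose, Fintype.card_coe]

lemma sum_rank {α : Type} [LinearOrder α] (C : Finset α) (f : ℕ → ℕ) :
    ∑ c ∈ C, f (C.filter (· < c)).card = ∑ j ∈ Finset.range C.card, f j := by
  induction C using Finset.induction_on_max with
  | empty => simp
  | insert a s h ih =>
    have ha : a ∉ s := fun h' => lt_irrefl _ (h a h')
    rw [Finset.sum_insert ha, Finset.card_insert_of_notMem ha, Finset.sum_range_succ, ← ih,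
      add_comm]
    congr 1
    · refine Finset.sum_congr rfl fun c hc => ?_
      rw [Finset.filter_insert, if_neg (h c hc).asymm]
    · rw [Finset.filter_insert, if_neg (lt_irrefl a), Finset.filter_true_of_mem h]

lemma sum_shift (n d : ℕ) (hn : 1 ≤ n) (hd : 1 ≤ d) :
    ∑ j ∈ Finset.range (d - 1), (Nat.multichoose d (n - 1) - Nat.multichoose (d - j) (n - 1)) =
      ∑ i ∈ Finset.Icc 2 (d - 1), (Nat.choose (n + d - 2) (n - 1) -
        Nat.choose (n + d - i - 1) (n - 1)) := by
  have e1 : ∀ j ∈ Finset.range (d - 1),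
      (Nat.multichoose d (n - 1) - Nat.multichoose (d - j) (n - 1)) =
      (Nat.choose (n + d - 2) (n - 1) - Nat.choose (n + d - (1 + j) - 1) (n - 1)) := by
    intro j hj
    rw [Finset.mem_range] at hj
    rw [Nat.multichoose_eq, Nat.multichoose_eq, show d + (n - 1) - 1 = n + d - 2 by omega,
      show d - j + (n - 1) - 1 = n + d - (1 + j) - 1 by omega]
  rw [Finset.sum_congr rfl e1]
  have e2 := Finset.sum_Ico_eq_sum_range (fun i => Nat.choose (n + d - 2) (n - 1) -
        Nat.choose (n + d - i - 1) (n - 1)) 1 d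
  rw [← e2]
  by_cases h : 1 < d
  · rw [Finset.sum_eq_sum_Ico_succ_bot h]
    rw [show n + d - 1 - 1 = n + d - 2 by omega, Nat.sub_self, zero_add]
    refine Finset.sum_congr ?_ fun _ _ => rfl
    ext i
    simp only [Finset.mem_Ico, Finset.mem_Icc]
    omega
  · have : d = 1 := by omega
    subst this
    simp

section

variable {N : Type} [LinearOrder N] [Fintype N] (T : RTree N) (n : ℕ)

open Classical in
/-- Children of `w`. -/
noncomputable def chd (w : N) : Finset N := Finset.univ.filter fun x => x ≠ T.root ∧ T.par x = w

lemma mem_chd {w x : N} : x ∈ chd T w ↔ x ≠ T.root ∧ T.par x = w := by simp [chd]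

lemma not_mem_chd (w : N) : w ∉ chd T w := by
  rw [mem_chd]
  rintro ⟨h, h'⟩
  have := T.depth_par w h
  rw [h'] at this
  omega

open Classical in
/-- Critical cells with given first entry, as a finset. -/
noncomputable def crf (c : N) : Finset (Sym N (n - 1)) :=
  (insert (T.par c) (chd T (T.par c))).sym (n - 1) \
    ((insert (T.par c) (chd T (T.par c))) \ (chd T (T.par c)).filter (· < c)).sym (n - 1)

lemma mem_crf {c : N} (hc : c ≠ T.root) (hn : 1 ≤ n) (m : Sym N (n - 1)) :
    m ∈ crf T n c ↔ T.Crit n c m.1 := by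
  have hm : m.1.card + 1 = n := by have := m.2; omega
  have e : ∀ x, x ∈ m ↔ x ∈ m.1 := fun x => Iff.rfl
  simp only [crf, Finset.mem_sdiff, Finset.mem_sym_iff, RTree.Crit, Finset.mem_insert, mem_chd,
    Finset.mem_filter, e]
  constructor
  · rintro ⟨h1, h2⟩
    refine ⟨hc, hm, h1, ?_⟩
    by_contra h3
    refine h2 fun x hx => ⟨h1 x hx, fun h4 => h3 ⟨x, hx, h4.1.1, h4.1.2, h4.2⟩⟩
  · rintro ⟨-, -, h1, s, hs, h2, h3, h4⟩
    exact ⟨h1, fun h => (h s hs).2 ⟨⟨h2, h3⟩, h4⟩⟩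

lemma card_crf (c : N) : (crf T n c).card =
    Nat.multichoose ((chd T (T.par c)).card + 1) (n - 1) -
      Nat.multichoose ((chd T (T.par c)).card + 1 - ((chd T (T.par c)).filter (· < c)).card)
        (n - 1) := by
  classical
  unfold crf
  rw [Finset.card_sdiff_of_subset (Finset.sym_mono Finset.sdiff_subset _), card_fsym, card_fsym,
    Finset.card_sdiff_of_subset ((Finset.filter_subset _ _).trans (Finset.subset_insert _ _)),
    Finset.card_insert_of_notMem (not_mem_chd T _)]

lemma card_K (hn : 1 ≤ n) : Nonempty (RTree.K T n ≃ Fin (∑ w : N,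
    ∑ i ∈ Finset.Icc 2 ((chd T w).card + 1 - 1),
      (Nat.choose (n + ((chd T w).card + 1) - 2) (n - 1) -
        Nat.choose (n + ((chd T w).card + 1) - i - 1) (n - 1)))) := by
  classical
  obtain ⟨Z, hZ⟩ : ∃ Z : Finset N, Z = Finset.univ.filter fun c : N => c ≠ T.root := ⟨_, rfl⟩
  have hZ' : ∀ c, c ∈ Z ↔ c ≠ T.root := fun c => by rw [hZ]; simp
  let E : RTree.K T n ≃ Σ c : Z, crf T n c.1 :=
    { toFun := fun k => ⟨⟨k.1.1, (hZ' _).2 k.2.1⟩,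
        ⟨⟨k.1.2, by have := k.2.2.1; omega⟩, (mem_crf T n k.2.1 hn _).2 k.2⟩⟩
      invFun := fun k => ⟨(k.1.1, k.2.1.1), (mem_crf T n ((hZ' _).1 k.1.2) hn _).1 k.2.2⟩
      left_inv := fun k => rfl
      right_inv := fun k => rfl }
  have hcard : Fintype.card (Σ c : Z,
      crf T n c.1) = ∑ w : N,
    ∑ i ∈ Finset.Icc 2 ((chd T w).card + 1 - 1),
      (Nat.choose (n + ((chd T w).card + 1) - 2) (n - 1) -
        Nat.choose (n + ((chd T w).card + 1) - i - 1) (n - 1)) := by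
    rw [Fintype.card_sigma]
    simp only [Fintype.card_coe]
    rw [Finset.sum_coe_sort Z (fun c => (crf T n c).card), ← Finset.sum_fiberwise _ T.par]
    refine Finset.sum_congr rfl fun w _ => ?_
    rw [← sum_shift n _ hn (by omega), Nat.add_sub_cancel,
      ← sum_rank (chd T w) fun j => Nat.multichoose ((chd T w).card + 1) (n - 1) -
        Nat.multichoose ((chd T w).card + 1 - j) (n - 1)]
    refine Finset.sum_congr ?_ ?_
    · ext x; simp [mem_chd, hZ']
    · intro x hx
      have hx' : T.par x = w := ((mem_chd T).1 hx).2
      rw [card_crf, hx']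
  exact ⟨E.trans (Fintype.equivFinOfCardEq hcard)⟩

end

section

variable {V : Type} {G : SimpleGraph V} {ρ : V} {T : RTree {v : V // v ≠ ρ}}

lemma ncard_nbr [LinearOrder {v : V // v ≠ ρ}] [Fintype {v : V // v ≠ ρ}]
    (hT : ∀ u v, G.Adj u v ↔ Ch T u v ∨ Ch T v u) (w : {v : V // v ≠ ρ}) :
    (G.neighborSet w.1).ncard = (chd T w).card + 1 := by
  classical
  have e : G.neighborSet w.1 =
      ↑(insert (up T w) ((chd T w).map (Function.Embedding.subtype _))) := by
    ext x
    rw [SimpleGraph.mem_neighborSet, hT]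
    simp only [Finset.coe_insert, Finset.coe_map, Set.mem_insert_iff, Set.mem_image,
      Finset.mem_coe, mem_chd]
    constructor
    · rintro (⟨h, h'⟩ | ⟨h, h'⟩)
      · right
        have h0 : (⟨x, h⟩ : {v : V // v ≠ ρ}) ≠ T.root := by
          intro h0; rw [h0, up_root] at h'; exact w.2 h'.symm
        rw [up_par h0] at h'
        exact ⟨⟨x, h⟩, ⟨h0, Subtype.ext h'⟩, rfl⟩
      · exact Or.inl h'.symm
    · rintro (rfl | ⟨y, ⟨h0, rfl⟩, rfl⟩)
      · exact Or.inr ⟨w.2, rfl⟩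
      · exact Or.inl ⟨y.2, up_par h0⟩
  rw [e, Set.ncard_coe_finset, Finset.card_insert_of_notMem, Finset.card_map]
  intro h
  obtain ⟨y, hy, h1⟩ := Finset.mem_map.1 h
  rw [mem_chd] at hy
  have h2 : y.1 = up T w := h1
  have a1 : Ch T y.1 w.1 := ⟨w.2, h2.symm⟩
  have a2 : Ch T w.1 y.1 := ⟨y.2, by rw [up_par hy.1, hy.2]⟩
  exact a1.asymm a2

end

lemma stmt18_aux {V : Type} [Fintype V] [DecidableEq V] (G : SimpleGraph V) (hG : G.IsTree)
    (hE : G.edgeSet.Nonempty) (n : ℕ) (hn : 1 ≤ n) (x₀ : UConf n (Realization G)) :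
    Nonempty (Abelianization (FundamentalGroup (UConf n (Realization G)) x₀) ≃*
      Multiplicative (FreeAbelianGroup (Fin (∑ v : V,
        ∑ i ∈ Finset.Icc 2 ((G.neighborSet v).ncard - 1),
          (Nat.choose (n + (G.neighborSet v).ncard - 2) (n - 1) -
            Nat.choose (n + (G.neighborSet v).ncard - i - 1) (n - 1)))))) := by
  classical
  have : Nontrivial V := by
    obtain ⟨e, he⟩ := hE
    induction e using Sym2.ind with
    | _ u v => exact ⟨u, v, G.ne_of_adj he⟩
  obtain ⟨ρ, hρ⟩ := hG.exists_vert_degree_one_of_nontrivial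
  obtain ⟨r, hr, hr'⟩ := SimpleGraph.degree_eq_one_iff_existsUnique_adj.1 hρ
  obtain ⟨T, hT⟩ := exists_rtree (ρ := ρ) (r := r) hG
    fun v => ⟨fun h => hr' v h, fun h => h ▸ hr⟩
  obtain ⟨e⟩ := exists_homeo hT
  obtain ⟨e1⟩ := uconf_homeo e n
  obtain ⟨e2⟩ := fg_homeo e1 x₀
  obtain ⟨o, ho⟩ := T.exists_dfs
  let _ := o
  obtain ⟨e3⟩ := RTree.model_iso ho (e1 x₀)
  obtain ⟨e4⟩ := card_K T n hn
  have hs : (∑ v : V, ∑ i ∈ Finset.Icc 2 ((G.neighborSet v).ncard - 1),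
          (Nat.choose (n + (G.neighborSet v).ncard - 2) (n - 1) -
            Nat.choose (n + (G.neighborSet v).ncard - i - 1) (n - 1))) = ∑ w : {v : V // v ≠ ρ},
      ∑ i ∈ Finset.Icc 2 ((chd T w).card + 1 - 1),
      (Nat.choose (n + ((chd T w).card + 1) - 2) (n - 1) -
        Nat.choose (n + ((chd T w).card + 1) - i - 1) (n - 1)) := by
    have hρ' : (G.neighborSet ρ).ncard = 1 := by
      rw [Set.ncard_eq_toFinset_card', ← hρ]; rfl
    rw [← Finset.add_sum_erase _ _ (Finset.mem_univ ρ), hρ']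
    simp only [← ncard_nbr hT]
    rw [Finset.Icc_eq_empty (by omega), Finset.sum_empty, zero_add]
    refine (Finset.sum_subtype (Finset.univ.erase ρ) (fun x => by simp) _)
  rw [hs]
  exact ⟨(e2.abelianizationCongr.trans e3).trans
    (AddEquiv.toMultiplicative (FreeAbelianGroup.equivOfEquiv e4))⟩

end GraphBraid


namespace GraphBraid

/-- For a finite tree `Γ` with at least one edge and `n ≥ 1`, the abelianization of the
braid group `B_n|Γ|` is free abelian of rank
`Σ_v Σ_{i=2}^{d(v)-1} [C(n + d(v) - 2, n - 1) - C(n + d(v) - i - 1, n - 1)]`,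
the outer sum running over the vertices of degree at least 3. -/
theorem stmt18 {V : Type} [Fintype V] [DecidableEq V] (G : SimpleGraph V) (hG : G.IsTree)
    (hE : G.edgeSet.Nonempty) (n : ℕ) (hn : 1 ≤ n) (x₀ : UConf n (Realization G)) :
    Nonempty (Abelianization (FundamentalGroup (UConf n (Realization G)) x₀) ≃*
      Multiplicative (FreeAbelianGroup (Fin (∑ v : V,
        ∑ i ∈ Finset.Icc 2 ((G.neighborSet v).ncard - 1),
          (Nat.choose (n + (G.neighborSet v).ncard - 2) (n - 1) -
            Nat.choose (n + (G.neighborSet v).ncard - i - 1) (n - 1)))))) :=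
  stmt18_aux G hG hE n hn x₀

end GraphBraid
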